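/- arXiv:2111.11273 — 2 statements merged into one kernel-verified Lean document; each statement's English description precedes it below -/
import Mathlib

section
/- Suppose Φ is irreducible and not of type G₂. Let Ψ ⊆ Φ⁺ be either a combinatorial ideal or a biconvex subset such that ⟨α,β⟩ ≥ 0 for all α, β ∈ Ψ, and let Γ ⊆ Ψ be an orthogonal subset. Then 𝔞_Γ = ⊕_{γ∈Γ} 𝔤_γ is a spherical subspace of 𝔫, i.e. ad(x)⁴ = 0 for every x ∈ 𝔞_Γ. -/
/- Background setup: a finite reduced crystallographic root system `Φ` with chosen
positive roots `Φ⁺` in a euclidean space `V`, the Cartan pairing, and the basic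
combinatorial notions used in the statement. -/

open scoped RealInnerProductSpace

noncomputable section

variable {V : Type*} [NormedAddCommGroup V] [InnerProductSpace ℝ V]

/-- The Cartan pairing `⟨α, β⟩ = 2 (α, β) / (β, β)`. -/
def cpair (α β : V) : ℝ := 2 * ⟪α, β⟫ / ⟪β, β⟫

/-- The reflection associated to `β`, as a linear endomorphism of `V`:
`v ↦ v - (2 (β, v)/(β, β)) • β`. -/
def reflEnd (β : V) : Module.End ℝ V :=
  LinearMap.id -
    (LinearMap.toSpanSingleton ℝ V β ∘ₗ ((2 / ⟪β, β⟫) • (innerSL ℝ β).toLinearMap))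

/-- A subset of `V` is orthogonal if the Cartan pairing of any two distinct
elements vanishes. -/
def OrthogonalSet (S : Set V) : Prop := ∀ γ ∈ S, ∀ γ' ∈ S, γ ≠ γ' → cpair γ γ' = 0

/-- A finite reduced crystallographic root system in the euclidean space `V`,
together with a choice of positive roots. -/
structure RootSystemData (V : Type*) [NormedAddCommGroup V] [InnerProductSpace ℝ V] where
  /-- the set of roots Φ -/
  roots : Set V
  /-- the set of positive roots Φ⁺ -/
  pos : Set V
  finite : roots.Finite
  ne_zero : ∀ α ∈ roots, α ≠ 0
  span_eq_top : Submodule.span ℝ roots = ⊤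
  reduced : ∀ α ∈ roots, ∀ t : ℝ, t • α ∈ roots → t = 1 ∨ t = -1
  crystallographic : ∀ α ∈ roots, ∀ β ∈ roots, ∃ n : ℤ, cpair α β = (n : ℝ)
  reflect_mem : ∀ α ∈ roots, ∀ β ∈ roots, reflEnd β α ∈ roots
  pos_subset : pos ⊆ roots
  pos_iff : ∀ α ∈ roots, (α ∈ pos ↔ ¬ (-α ∈ pos))
  pos_add : ∀ α ∈ pos, ∀ β ∈ pos, α + β ∈ roots → α + β ∈ pos

namespace RootSystemData

variable (D : RootSystemData V)

/-- Irreducibility: the roots admit no nontrivial partition into two mutually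
orthogonal parts. -/
def IsIrreducible : Prop :=
  D.roots.Nonempty ∧
    ∀ s ⊆ D.roots, (∀ α ∈ s, ∀ β ∈ D.roots \ s, ⟪α, β⟫ = 0) → s = ∅ ∨ s = D.roots

/-- An irreducible root system is not of type `G₂` iff no Cartan pairing of two
roots equals `±3`. -/
def NotG2 : Prop := ∀ α ∈ D.roots, ∀ β ∈ D.roots, cpair α β ≠ 3 ∧ cpair α β ≠ -3

/-- An irreducible root system is of type `G₂` iff some Cartan pairing of two
roots equals `±3`. -/
def IsG2 : Prop :=
  D.IsIrreducible ∧ ∃ α ∈ D.roots, ∃ β ∈ D.roots, cpair α β = 3 ∨ cpair α β = -3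

/-- All roots have the same length (types A, D, E). -/
def SimplyLaced : Prop := ∀ α ∈ D.roots, ∀ β ∈ D.roots, ⟪α, α⟫ = ⟪β, β⟫

/-- There are exactly two root lengths, with squared-length ratio 2
(types B, C, F₄). -/
def DoublyLaced : Prop :=
  (∃ α ∈ D.roots, ∃ β ∈ D.roots, ⟪β, β⟫ = 2 * ⟪α, α⟫) ∧
    ∀ α ∈ D.roots, ∀ β ∈ D.roots,
      ⟪α, α⟫ = ⟪β, β⟫ ∨ ⟪β, β⟫ = 2 * ⟪α, α⟫ ∨ ⟪α, α⟫ = 2 * ⟪β, β⟫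

/-- A root of maximal length. -/
def IsLong (α : V) : Prop := α ∈ D.roots ∧ ∀ β ∈ D.roots, ⟪β, β⟫ ≤ ⟪α, α⟫

/-- A root of minimal length. -/
def IsShort (α : V) : Prop := α ∈ D.roots ∧ ∀ β ∈ D.roots, ⟪α, α⟫ ≤ ⟪β, β⟫

/-- A set of positive roots is convex if any root which is a linear combination of
two of its elements with positive coefficients lies in it. -/
def ConvexSubset (S : Set V) : Prop :=
  ∀ α ∈ S, ∀ β ∈ S, ∀ a b : ℝ, 0 < a → 0 < b →
    a • α + b • β ∈ D.roots → a • α + b • β ∈ S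

/-- A subset `Ψ ⊆ Φ⁺` is biconvex if both `Ψ` and `Φ⁺ \ Ψ` are convex. -/
def Biconvex (S : Set V) : Prop :=
  S ⊆ D.pos ∧ D.ConvexSubset S ∧ D.ConvexSubset (D.pos \ S)

/-- A subset `Ψ ⊆ Φ⁺` is a combinatorial ideal if `α ∈ Ψ`, `β ∈ Φ⁺`, `α + β ∈ Φ⁺`
imply `α + β ∈ Ψ`. -/
def CombIdeal (S : Set V) : Prop :=
  S ⊆ D.pos ∧ ∀ α ∈ S, ∀ β ∈ D.pos, α + β ∈ D.pos → α + β ∈ S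

end RootSystemData

/- The Lie-theoretic setup: a finite-dimensional complex simple Lie algebra `𝔤`
with Cartan subalgebra `𝔱`, whose root space decomposition is indexed by the
root system `Φ ⊆ V`. -/

/-- A finite-dimensional simple complex Lie algebra `L`, together with a Cartan
subalgebra and its root space decomposition, whose root system is `Φ ⊆ V` with a
choice of positive roots (determining the Borel subalgebra `𝔟 = 𝔱 ⊕ 𝔫`). -/
structure LieRootData (V : Type*) [NormedAddCommGroup V] [InnerProductSpace ℝ V]
    (L : Type*) [LieRing L] [LieAlgebra ℂ L] extends RootSystemData V where
  /-- the Cartan subalgebra 𝔱 -/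
  cartan : LieSubalgebra ℂ L
  /-- the root space 𝔤_α attached to each root α -/
  rs : V → Submodule ℂ L
  finiteDim : FiniteDimensional ℂ L
  isSimple : LieAlgebra.IsSimple ℂ L
  isCartan : cartan.IsCartanSubalgebra
  rs_dim : ∀ α ∈ roots, Module.finrank ℂ (rs α) = 1
  sup_eq_top : cartan.toSubmodule ⊔ (⨆ α ∈ roots, rs α) = ⊤
  indep : ∀ α ∈ roots, rs α ⊓ (cartan.toSubmodule ⊔ ⨆ β ∈ roots \ {α}, rs β) = ⊥
  weight_vec : ∀ α ∈ roots, ∀ h ∈ cartan, ∀ x ∈ rs α, ∃ c : ℂ, ⁅h, x⁆ = c • x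
  bracket_mem : ∀ α ∈ roots, ∀ β ∈ roots, α + β ∈ roots →
    ∀ x ∈ rs α, ∀ y ∈ rs β, ⁅x, y⁆ ∈ rs (α + β)
  bracket_ne_zero : ∀ α ∈ roots, ∀ β ∈ roots, α + β ∈ roots →
    ∀ x ∈ rs α, x ≠ 0 → ∀ y ∈ rs β, y ≠ 0 → ⁅x, y⁆ ≠ 0
  bracket_eq_zero : ∀ α ∈ roots, ∀ β ∈ roots, α + β ∉ roots → α + β ≠ 0 →
    ∀ x ∈ rs α, ∀ y ∈ rs β, ⁅x, y⁆ = 0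
  bracket_cartan_mem : ∀ α ∈ roots, ∀ x ∈ rs α, ∀ y ∈ rs (-α), ⁅x, y⁆ ∈ cartan

namespace LieRootData

variable {L : Type*} [LieRing L] [LieAlgebra ℂ L] (D : LieRootData V L)

/-- The nilradical `𝔫 = ⊕_{α ∈ Φ⁺} 𝔤_α` of the Borel subalgebra, as a submodule. -/
def nilrad : Submodule ℂ L := ⨆ α ∈ D.pos, D.rs α

/-- The Borel subalgebra `𝔟 = 𝔱 ⊕ 𝔫`, as a submodule. -/
def borel : Submodule ℂ L := D.cartan.toSubmodule ⊔ D.nilrad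

/-- The subspace `𝔞_Ψ = ⊕_{α ∈ Ψ} 𝔤_α` attached to a subset `Ψ ⊆ Φ⁺`. -/
def aSubspace (S : Set V) : Submodule ℂ L := ⨆ α ∈ S, D.rs α

end LieRootData

/-- A subspace of `𝔫` is spherical if `ad(x)^4 = 0` for every `x` in it. -/
def IsSphericalSubspace {L : Type*} [LieRing L] [LieAlgebra ℂ L]
    (a : Submodule ℂ L) : Prop :=
  ∀ x ∈ a, (LieAlgebra.ad ℂ L x) ^ 4 = 0

/-- The height of a nilpotent element `x`: `max {n | ad(x)^n ≠ 0}`. -/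
noncomputable def heightOf {L : Type*} [LieRing L] [LieAlgebra ℂ L] (x : L) : ℕ :=
  sSup {n : ℕ | (LieAlgebra.ad ℂ L x) ^ n ≠ 0}

section Helpers

theorem reflEnd_eq (β v : V) : reflEnd β v = v - cpair v β • β := by
  simp only [reflEnd, cpair, LinearMap.sub_apply, LinearMap.id_apply, LinearMap.comp_apply,
    LinearMap.smul_apply, LinearMap.toSpanSingleton_apply, smul_eq_mul,
    ContinuousLinearMap.coe_coe, innerSL_apply_apply]
  rw [real_inner_comm v β]
  congr 2
  ring

namespace RootSystemData

variable (D : RootSystemData V)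

theorem inner_pos_of_root {α : V} (h : α ∈ D.roots) : 0 < ⟪α, α⟫ :=
  real_inner_self_pos.mpr (D.ne_zero α h)

/-- Reflection membership in the form convenient for computations. -/
theorem refl_mem' {α β : V} (ha : α ∈ D.roots) (hb : β ∈ D.roots) (c : ℝ)
    (hc : 2 * ⟪α, β⟫ = c * ⟪β, β⟫) : α - c • β ∈ D.roots := by
  have h := D.reflect_mem α ha β hb
  rw [reflEnd_eq] at h
  have hp := D.inner_pos_of_root hb
  have : cpair α β = c := by
    unfold cpair
    rw [hc]
    field_simp
  rwa [this] at h

theorem neg_mem {α : V} (ha : α ∈ D.roots) : -α ∈ D.roots := by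
  have h := D.refl_mem' ha ha 2 rfl
  have e : α - (2 : ℝ) • α = -α := by module
  rwa [e] at h

/-- If `⟪α, δ⟫` lies strictly between `0` and `⟪δ, δ⟫ / 2`, then `δ` is not a root. -/
theorem not_root {α δ : V} (ha : α ∈ D.roots) (h1 : 0 < ⟪α, δ⟫) (h2 : 2 * ⟪α, δ⟫ < ⟪δ, δ⟫) :
    δ ∉ D.roots := by
  intro hd
  obtain ⟨n, hn⟩ := D.crystallographic α ha δ hd
  have hp := D.inner_pos_of_root hd
  unfold cpair at hn
  rw [div_eq_iff hp.ne'] at hn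
  have h3 : (0 : ℝ) < n := by
    by_contra hc
    push Not at hc
    nlinarith
  have h4 : (n : ℝ) < 1 := by
    by_contra hc
    push Not at hc
    nlinarith
  have h5 : 0 < n := by exact_mod_cast h3
  have h6 : n < 1 := by exact_mod_cast h4
  omega

theorem pos_or {α : V} (ha : α ∈ D.roots) : α ∈ D.pos ∨ -α ∈ D.pos := by
  by_cases h : -α ∈ D.pos
  · exact Or.inr h
  · exact Or.inl ((D.pos_iff α ha).mpr h)

section Cases

variable {D} {Ψ : Set V} (hΨ : D.CombIdeal Ψ ∨ D.Biconvex Ψ)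
  (hpos : ∀ α ∈ Ψ, ∀ β ∈ Ψ, 0 ≤ cpair α β)

theorem psi_pos (hΨ : D.CombIdeal Ψ ∨ D.Biconvex Ψ) {α : V} (h : α ∈ Ψ) : α ∈ D.pos := by
  rcases hΨ with h' | h'
  · exact h'.1 h
  · exact h'.1 h

theorem psi_root (hΨ : D.CombIdeal Ψ ∨ D.Biconvex Ψ) {α : V} (h : α ∈ Ψ) : α ∈ D.roots :=
  D.pos_subset (psi_pos hΨ h)

theorem not_psi (hΨ : D.CombIdeal Ψ ∨ D.Biconvex Ψ)
    (hpos : ∀ α ∈ Ψ, ∀ β ∈ Ψ, 0 ≤ cpair α β) {α γ : V} (hγ : γ ∈ Ψ) (h : ⟪α, γ⟫ < 0) :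
    α ∉ Ψ := by
  intro ha
  have h1 := hpos α ha γ hγ
  have h2 := D.inner_pos_of_root (psi_root hΨ hγ)
  unfold cpair at h1
  have := div_neg_of_neg_of_pos (show 2 * ⟪α, γ⟫ < 0 by linarith) h2
  linarith

/-- The complement of a biconvex set is closed under addition. -/
theorem coconvex (h : D.Biconvex Ψ) {α β γ : V} (ha : α ∈ D.pos) (ha' : α ∉ Ψ)
    (hb : β ∈ D.pos) (hb' : β ∉ Ψ) (hγ : γ ∈ Ψ) (e : α + β = γ) : False := by
  have h1 := h.2.2 α ⟨ha, ha'⟩ β ⟨hb, hb'⟩ 1 1 one_pos one_pos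
  rw [one_smul, one_smul, e] at h1
  exact (h1 (D.pos_subset (h.1 hγ))).2 hγ

/-- Four equal length orthogonal roots with half sum a root: auxiliary step. -/
theorem caseA_aux (hΨ : D.CombIdeal Ψ ∨ D.Biconvex Ψ)
    (hpos : ∀ α ∈ Ψ, ∀ β ∈ Ψ, 0 ≤ cpair α β)
    {β a b c d : V} (hβ : β ∈ D.roots)
    (ha : a ∈ Ψ) (hb : b ∈ Ψ) (hc : c ∈ Ψ) (hd : d ∈ Ψ)
    (hbd : ⟪b, d⟫ = 0)
    (na : ⟪b, b⟫ = 2 * ⟪β, b⟫) (nc : ⟪c, c⟫ = 2 * ⟪β, c⟫) (nd : ⟪d, d⟫ = 2 * ⟪β, d⟫)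
    (hsum : (2 : ℝ) • β = a + b + c + d)
    (h1 : β - c - d ∈ D.pos) (h2 : β - b - d ∈ D.pos) : False := by
  have pb := D.inner_pos_of_root (psi_root hΨ hb)
  have pc := D.inner_pos_of_root (psi_root hΨ hc)
  have pd := D.inner_pos_of_root (psi_root hΨ hd)
  have rd : β - d ∈ D.roots := by
    have := D.refl_mem' hβ (psi_root hΨ hd) 1 (by linarith)
    rwa [one_smul] at this
  have rc : β - c ∈ D.roots := by
    have := D.refl_mem' hβ (psi_root hΨ hc) 1 (by linarith)
    rwa [one_smul] at this
  have nd' : β - d ∉ Ψ := not_psi hΨ hpos hd (by rw [inner_sub_left]; linarith)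
  have nc' : β - c ∉ Ψ := not_psi hΨ hpos hc (by rw [inner_sub_left]; linarith)
  have n1 : β - b - d ∉ Ψ := not_psi hΨ hpos hb (by
    rw [inner_sub_left, inner_sub_left, real_inner_comm b d, hbd]; linarith)
  rcases hΨ with h | h
  · have e : c + (β - c - d) = β - d := by abel
    have h3 : c + (β - c - d) ∈ D.pos := D.pos_add c (h.1 hc) _ h1 (by rwa [e])
    have h4 := h.2 c hc _ h1 h3
    rw [e] at h4
    exact nd' h4
  · have e : d + (β - c - d) = β - c := by abel
    have h3 : d + (β - c - d) ∈ D.pos := D.pos_add d (h.1 hd) _ h1 (by rwa [e])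
    rw [e] at h3
    refine coconvex h h3 nc' h2 n1 ha ?_
    have : (β - c) + (β - b - d) = (2 : ℝ) • β - b - c - d := by module
    rw [this, hsum]
    abel

theorem caseA (hΨ : D.CombIdeal Ψ ∨ D.Biconvex Ψ)
    (hpos : ∀ α ∈ Ψ, ∀ β ∈ Ψ, 0 ≤ cpair α β)
    {β a b c d : V} (hβ : β ∈ D.roots)
    (ha : a ∈ Ψ) (hb : b ∈ Ψ) (hc : c ∈ Ψ) (hd : d ∈ Ψ)
    (hab : ⟪a, b⟫ = 0) (hac : ⟪a, c⟫ = 0) (had : ⟪a, d⟫ = 0)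
    (hbc : ⟪b, c⟫ = 0) (hbd : ⟪b, d⟫ = 0) (hcd : ⟪c, d⟫ = 0)
    (na : ⟪a, a⟫ = 2 * ⟪β, a⟫) (nb : ⟪b, b⟫ = 2 * ⟪β, b⟫)
    (nc : ⟪c, c⟫ = 2 * ⟪β, c⟫) (nd : ⟪d, d⟫ = 2 * ⟪β, d⟫)
    (hsum : (2 : ℝ) • β = a + b + c + d) : False := by
  have rd : β - d ∈ D.roots := by
    have := D.refl_mem' hβ (psi_root hΨ hd) 1 (by linarith)
    rwa [one_smul] at this
  have rcd : β - c - d ∈ D.roots := by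
    have := D.refl_mem' rd (psi_root hΨ hc) 1 (by
      rw [inner_sub_left, real_inner_comm c d, hcd]; linarith)
    rw [one_smul] at this
    rwa [sub_right_comm]
  have rbd : β - b - d ∈ D.roots := by
    have := D.refl_mem' rd (psi_root hΨ hb) 1 (by
      rw [inner_sub_left, real_inner_comm b d, hbd]; linarith)
    rw [one_smul] at this
    rwa [sub_right_comm]
  have hb2 : a + b + c + d - β = β := by rw [← hsum]; module
  have e1 : -(β - c - d) = β - a - b := by
    nth_rewrite 2 [← hb2]; abel
  have e2 : -(β - b - d) = β - a - c := by
    nth_rewrite 2 [← hb2]; abel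
  have hba := (real_inner_comm a b).trans hab
  have hca := (real_inner_comm a c).trans hac
  have hda := (real_inner_comm a d).trans had
  have hcb := (real_inner_comm b c).trans hbc
  have hdb := (real_inner_comm b d).trans hbd
  have hdc := (real_inner_comm c d).trans hcd
  rcases D.pos_or rcd with h1 | h1 <;> rcases D.pos_or rbd with h2 | h2
  · exact caseA_aux hΨ hpos hβ ha hb hc hd hbd nb nc nd hsum h1 h2
  · rw [e2] at h2
    -- shared element `c`
    exact caseA_aux hΨ hpos hβ hb ha hd hc hac na nd nc (by rw [hsum]; abel)
      (by rwa [sub_right_comm]) h2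
  · rw [e1] at h1
    -- shared element `b`
    exact caseA_aux hΨ hpos hβ hc hd ha hb hdb nd na nb (by rw [hsum]; abel)
      h1 (by rwa [sub_right_comm])
  · rw [e1] at h1
    rw [e2] at h2
    -- shared element `a`
    exact caseA_aux hΨ hpos hβ hd hc hb ha hca nc nb na (by rw [hsum]; abel)
      (by rwa [sub_right_comm]) (by rwa [sub_right_comm])

theorem caseB_aux (hΨ : D.CombIdeal Ψ ∨ D.Biconvex Ψ)
    (hpos : ∀ α ∈ Ψ, ∀ β ∈ Ψ, 0 ≤ cpair α β)
    {β a b c : V} (hβ : β ∈ D.roots)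
    (ha : a ∈ Ψ) (hb : b ∈ Ψ) (hc : c ∈ Ψ)
    (hab : ⟪a, b⟫ = 0) (hcb : ⟪c, b⟫ = 0)
    (na : ⟪a, a⟫ = 2 * ⟪β, a⟫) (nb : ⟪b, b⟫ = 2 * ⟪β, b⟫) (nc : ⟪c, c⟫ = ⟪β, c⟫)
    (hsum : (2 : ℝ) • β = a + b + (2 : ℝ) • c)
    (h1 : a + c - β ∈ D.pos) : False := by
  have pa := D.inner_pos_of_root (psi_root hΨ ha)
  have pb := D.inner_pos_of_root (psi_root hΨ hb)
  have pc := D.inner_pos_of_root (psi_root hΨ hc)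
  have ra : β - a ∈ D.roots := by
    have := D.refl_mem' hβ (psi_root hΨ ha) 1 (by linarith)
    rwa [one_smul] at this
  have rb : β - b ∈ D.roots := by
    have := D.refl_mem' hβ (psi_root hΨ hb) 1 (by linarith)
    rwa [one_smul] at this
  have rc : β - (2 : ℝ) • c ∈ D.roots := D.refl_mem' hβ (psi_root hΨ hc) 2 (by linarith)
  have ka : β - a ∉ Ψ := not_psi hΨ hpos ha (by rw [inner_sub_left]; linarith)
  have kb : β - b ∉ Ψ := not_psi hΨ hpos hb (by rw [inner_sub_left]; linarith)
  have kc : β - (2 : ℝ) • c ∉ Ψ := not_psi hΨ hpos hc (by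
    rw [inner_sub_left, real_inner_smul_left]; linarith)
  have ke : a + c - β ∉ Ψ := not_psi hΨ hpos hb (by
    rw [inner_sub_left, inner_add_left, hab, hcb]; linarith)
  have e : c + (a + c - β) = β - b := by
    have : c + (a + c - β) = (a + b + (2 : ℝ) • c) - b - β := by module
    rw [this, ← hsum]; module
  have h3 : c + (a + c - β) ∈ D.pos := D.pos_add c (psi_pos hΨ hc) _ h1 (by rwa [e])
  rcases hΨ with h | h
  · have h4 := h.2 c hc _ h1 h3
    rw [e] at h4
    exact kb h4
  · rw [e] at h3
    rcases D.pos_or ra with h4 | h4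
    · exact coconvex h h1 ke h4 ka hc (by abel)
    · have e2 : b + -(β - a) = β - (2 : ℝ) • c := by
        have : b + -(β - a) = (a + b + (2 : ℝ) • c) - (2 : ℝ) • c - β := by module
        rw [this, ← hsum]; module
      have h5 : b + -(β - a) ∈ D.pos := D.pos_add b (h.1 hb) _ h4 (by rwa [e2])
      rw [e2] at h5
      refine coconvex h h5 kc h3 kb ha ?_
      have : β - (2 : ℝ) • c + (β - b) = (2 : ℝ) • β - b - (2 : ℝ) • c := by module
      rw [this, hsum]
      abel

theorem caseB (hΨ : D.CombIdeal Ψ ∨ D.Biconvex Ψ)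
    (hpos : ∀ α ∈ Ψ, ∀ β ∈ Ψ, 0 ≤ cpair α β)
    {β a b c : V} (hβ : β ∈ D.roots)
    (ha : a ∈ Ψ) (hb : b ∈ Ψ) (hc : c ∈ Ψ)
    (hab : ⟪a, b⟫ = 0) (hac : ⟪a, c⟫ = 0) (hbc : ⟪b, c⟫ = 0)
    (na : ⟪a, a⟫ = 2 * ⟪β, a⟫) (nb : ⟪b, b⟫ = 2 * ⟪β, b⟫) (nc : ⟪c, c⟫ = ⟪β, c⟫)
    (mc : ⟪β, β⟫ = 2 * ⟪β, c⟫)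
    (hsum : (2 : ℝ) • β = a + b + (2 : ℝ) • c) : False := by
  have hba := (real_inner_comm a b).trans hab
  have hca := (real_inner_comm a c).trans hac
  have hcb := (real_inner_comm b c).trans hbc
  have ra : β - a ∈ D.roots := by
    have := D.refl_mem' hβ (psi_root hΨ ha) 1 (by linarith)
    rwa [one_smul] at this
  have re : a + c - β ∈ D.roots := by
    have := D.refl_mem' (psi_root hΨ hc) ra 1 (by
      rw [inner_sub_right, inner_sub_left, inner_sub_right, inner_sub_right, hca,
        real_inner_comm β c, real_inner_comm β a]; linarith)
    rw [one_smul] at this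
    have e : a + c - β = c - (β - a) := by abel
    rwa [e]
  have e : -(a + c - β) = b + c - β := by
    have : b + c - β = (a + b + (2 : ℝ) • c) - a - c - β := by module
    rw [this, ← hsum]; module
  rcases D.pos_or re with h | h
  · exact caseB_aux hΨ hpos hβ ha hb hc hab hcb na nb nc hsum h
  · rw [e] at h
    exact caseB_aux hΨ hpos hβ hb ha hc hba hca nb na nc (by rw [hsum]; abel) h

end Cases

end RootSystemData

end Helpers

section Helpers2

namespace RootSystemData

variable {D : RootSystemData V}

/-- The degree bound. -/
theorem degree_lt (hG2 : D.NotG2) {Ψ : Set V} (hΨ : D.CombIdeal Ψ ∨ D.Biconvex Ψ)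
    (hpos : ∀ α ∈ Ψ, ∀ β ∈ Ψ, 0 ≤ cpair α β)
    (s : Finset V) (hs : ∀ γ ∈ s, γ ∈ Ψ)
    (ho : ∀ γ ∈ s, ∀ γ' ∈ s, γ ≠ γ' → ⟪γ, γ'⟫ = 0)
    (hadd : ∀ γ ∈ s, ∀ γ' ∈ s, γ ≠ γ' → γ + γ' ∉ D.roots)
    {β : V} (hβ : β ∈ D.roots) : ∑ γ ∈ s, cpair β γ < 4 := by
  classical
  by_contra hcon
  push Not at hcon
  have hr : ∀ γ ∈ s, γ ∈ D.roots := fun γ h => psi_root hΨ (hs γ h)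
  have pβ := D.inner_pos_of_root hβ
  have key : ∀ γ ∈ s, ∃ n m : ℤ, cpair β γ = n ∧ 2 * ⟪β, γ⟫ = n * ⟪γ, γ⟫ ∧
      2 * ⟪β, γ⟫ = m * ⟪β, β⟫ ∧ n ≤ n * m ∧ (m = 1 → 0 < n) ∧ (m = 0 → n = 0) := by
    intro γ hγ
    have pγ := D.inner_pos_of_root (hr γ hγ)
    obtain ⟨n, hn⟩ := D.crystallographic β hβ γ (hr γ hγ)
    obtain ⟨m, hm⟩ := D.crystallographic γ (hr γ hγ) β hβ
    have hn' := hn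
    unfold cpair at hn hm
    rw [div_eq_iff pγ.ne'] at hn
    rw [div_eq_iff pβ.ne', real_inner_comm] at hm
    have hnm : (n : ℝ) * ⟪γ, γ⟫ = m * ⟪β, β⟫ := by linarith
    have hp : 0 < n → 0 < m := by
      intro h
      have h' : (0 : ℝ) < n := by exact_mod_cast h
      have : (0 : ℝ) < m := by
        by_contra hc
        push Not at hc
        nlinarith [mul_pos h' pγ]
      exact_mod_cast this
    have hp' : 0 < m → 0 < n := by
      intro h
      have h' : (0 : ℝ) < m := by exact_mod_cast h
      have : (0 : ℝ) < n := by
        by_contra hc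
        push Not at hc
        nlinarith [mul_pos h' pβ]
      exact_mod_cast this
    have hq : n < 0 → m < 0 := by
      intro h
      have h' : (n : ℝ) < 0 := by exact_mod_cast h
      have : (m : ℝ) < 0 := by
        by_contra hc
        push Not at hc
        nlinarith [mul_neg_of_neg_of_pos h' pγ, mul_nonneg hc pβ.le]
      exact_mod_cast this
    refine ⟨n, m, hn', hn, hm, ?_, ?_, ?_⟩
    · rcases lt_trichotomy n 0 with h | h | h
      · have := hq h
        nlinarith
      · subst h; simp
      · have := hp h
        nlinarith
    · intro h; exact hp' (by omega)
    · intro h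
      rcases lt_trichotomy n 0 with h' | h' | h'
      · have := hq h'; omega
      · exact h'
      · have := hp h'; omega
  choose! n m hn h2n h2m hle hm1 hm0 using key
  have hsumn : ∑ γ ∈ s, cpair β γ = ((∑ γ ∈ s, n γ : ℤ) : ℝ) := by
    push_cast
    exact Finset.sum_congr rfl hn
  have h4 : 4 ≤ ∑ γ ∈ s, n γ := by
    rw [hsumn] at hcon
    exact_mod_cast hcon
  have h5 : ∑ γ ∈ s, n γ ≤ ∑ γ ∈ s, n γ * m γ := Finset.sum_le_sum hle
  -- Bessel
  set w : V := ∑ γ ∈ s, ((n γ : ℝ) / 2) • γ with hw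
  have hwβ : ⟪β, w⟫ = (∑ γ ∈ s, (n γ : ℝ) * m γ) * ⟪β, β⟫ / 4 := by
    rw [hw, inner_sum, Finset.sum_mul, Finset.sum_div]
    refine Finset.sum_congr rfl fun γ hγ => ?_
    rw [real_inner_smul_right]
    linear_combination (n γ : ℝ) / 4 * h2m γ hγ
  have hww : ⟪w, w⟫ = (∑ γ ∈ s, (n γ : ℝ) * m γ) * ⟪β, β⟫ / 4 := by
    have : ∀ γ ∈ s, ⟪γ, w⟫ = (n γ : ℝ) / 2 * ⟪γ, γ⟫ := by
      intro γ hγ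
      rw [hw, inner_sum, Finset.sum_eq_single γ]
      · rw [real_inner_smul_right]
      · intro b hb hne
        rw [real_inner_smul_right, ho γ hγ b hb (Ne.symm hne), mul_zero]
      · intro h; exact absurd hγ h
    conv_lhs => rw [hw, sum_inner]
    rw [Finset.sum_mul, Finset.sum_div]
    refine Finset.sum_congr rfl fun γ hγ => ?_
    rw [real_inner_smul_left, ← hw, this γ hγ]
    linear_combination (n γ : ℝ) / 4 * (h2m γ hγ - h2n γ hγ)
  have hd : ⟪β - w, β - w⟫ = ⟪β, β⟫ - (∑ γ ∈ s, (n γ : ℝ) * m γ) * ⟪β, β⟫ / 4 := by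
    rw [inner_sub_left, inner_sub_right, inner_sub_right, real_inner_comm β w, hwβ, hww]
    ring
  have h6 : ∑ γ ∈ s, n γ * m γ ≤ 4 := by
    have h := real_inner_self_nonneg (x := β - w)
    rw [hd] at h
    have : ∑ γ ∈ s, (n γ : ℝ) * m γ ≤ 4 := by
      by_contra hc
      push Not at hc
      nlinarith
    exact_mod_cast this
  have h7 : ∑ γ ∈ s, n γ * m γ = 4 := by omega
  have h8 : ∑ γ ∈ s, n γ = 4 := by omega
  have hβw : β = w := by
    have : ∑ γ ∈ s, (n γ : ℝ) * m γ = 4 := by exact_mod_cast h7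
    rw [this] at hd
    have h0 : ⟪β - w, β - w⟫ = 0 := by rw [hd]; ring
    exact sub_eq_zero.mp (inner_self_eq_zero.mp h0)
  have h9 : ∀ γ ∈ s, n γ = n γ * m γ :=
    (Finset.sum_eq_sum_iff_of_le hle).mp (by omega)
  have h10 : ∀ γ ∈ s, n γ = 0 ∨ (m γ = 1 ∧ 0 < n γ) := by
    intro γ hγ
    by_cases h : n γ = 0
    · exact Or.inl h
    · have : m γ = 1 := by
        have := h9 γ hγ
        have h' : n γ * (m γ - 1) = 0 := by linarith
        rcases mul_eq_zero.mp h' with h'' | h''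
        · exact absurd h'' h
        · omega
      exact Or.inr ⟨this, hm1 γ hγ this⟩
  have hnn : ∀ γ ∈ s, 0 ≤ n γ := by
    intro γ hγ
    rcases h10 γ hγ with h | h <;> omega
  have h11 : ∀ γ ∈ s, n γ = 0 ∨ n γ = 1 ∨ n γ = 2 := by
    intro γ hγ
    have hl : n γ ≤ 4 := by
      rw [← h8]
      exact Finset.single_le_sum hnn hγ
    have h3 : n γ ≠ 3 := by
      intro h
      have := (hG2 β hβ γ (hr γ hγ)).1
      rw [hn γ hγ, h] at this
      exact this (by norm_num)
    have h4' : n γ ≠ 4 := by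
      intro h
      have hm : m γ = 1 := by
        rcases h10 γ hγ with h' | h'
        · omega
        · exact h'.1
      have e1 := h2n γ hγ
      have e2 := h2m γ hγ
      rw [h] at e1
      rw [hm] at e2
      push_cast at e1 e2
      have h0 : ⟪β - (2 : ℝ) • γ, β - (2 : ℝ) • γ⟫ = 0 := by
        rw [inner_sub_left, inner_sub_right, inner_sub_right, real_inner_smul_left,
          real_inner_smul_right, real_inner_smul_right, real_inner_smul_left,
          real_inner_comm β γ]
        linarith
      have h1 := sub_eq_zero.mp (inner_self_eq_zero.mp h0)
      rw [h1] at hβ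
      rcases D.reduced γ (hr γ hγ) 2 hβ with h | h <;> norm_num at h
    have := hnn γ hγ
    omega
  have hcard : ∑ γ ∈ s, n γ =
      ((s.filter (fun γ => n γ = 1)).card : ℤ) + 2 * (s.filter (fun γ => n γ = 2)).card := by
    rw [Finset.card_filter, Finset.card_filter]
    push_cast
    rw [Finset.mul_sum, ← Finset.sum_add_distrib]
    refine Finset.sum_congr rfl fun γ hγ => ?_
    rcases h11 γ hγ with h | h | h <;> simp [h]
  have hdec : (2 : ℝ) • β = ∑ γ ∈ s.filter (fun γ => n γ = 1), γ +
      ∑ γ ∈ s.filter (fun γ => n γ = 2), (2 : ℝ) • γ := by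
    rw [Finset.sum_filter, Finset.sum_filter, ← Finset.sum_add_distrib, hβw, hw,
      Finset.smul_sum]
    refine Finset.sum_congr rfl fun γ hγ => ?_
    rcases h11 γ hγ with h | h | h <;> simp [h]
  have f1 : ∀ γ ∈ s.filter (fun γ => n γ = 1), γ ∈ s ∧ γ ∈ Ψ ∧ ⟪γ, γ⟫ = 2 * ⟪β, γ⟫ := by
    intro γ hγ
    rw [Finset.mem_filter] at hγ
    have := h2n γ hγ.1
    rw [hγ.2] at this
    push_cast at this
    exact ⟨hγ.1, hs γ hγ.1, by linarith⟩
  have f2 : ∀ γ ∈ s.filter (fun γ => n γ = 2), γ ∈ s ∧ γ ∈ Ψ ∧ ⟪γ, γ⟫ = ⟪β, γ⟫ ∧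
      ⟪β, β⟫ = 2 * ⟪β, γ⟫ := by
    intro γ hγ
    rw [Finset.mem_filter] at hγ
    have := h2n γ hγ.1
    have h' := h2m γ hγ.1
    have hm : m γ = 1 := by
      rcases h10 γ hγ.1 with h' | h'
      · omega
      · exact h'.1
    rw [hm] at h'
    rw [hγ.2] at this
    push_cast at this h'
    exact ⟨hγ.1, hs γ hγ.1, by linarith, by linarith⟩
  have hdisj : ∀ γ ∈ s.filter (fun γ => n γ = 1), ∀ γ' ∈ s.filter (fun γ => n γ = 2),
      γ ≠ γ' := by
    intro γ h γ' h' e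
    rw [Finset.mem_filter] at h h'
    rw [e] at h
    omega
  rw [h8] at hcard
  generalize s.filter (fun γ => n γ = 1) = T1 at *
  generalize s.filter (fun γ => n γ = 2) = T2 at *
  have hc : (T1.card = 4 ∧ T2.card = 0) ∨ (T1.card = 2 ∧ T2.card = 1) ∨
      (T1.card = 0 ∧ T2.card = 2) := by omega
  rcases hc with ⟨c1, c2⟩ | ⟨c1, c2⟩ | ⟨c1, c2⟩
  · obtain ⟨a, b, c, d, hab, hac, had, hbc, hbd, hcd, rfl⟩ := Finset.card_eq_four.mp c1
    rw [Finset.card_eq_zero] at c2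
    subst c2
    obtain ⟨a1, a2, a3⟩ := f1 a (by simp)
    obtain ⟨b1, b2, b3⟩ := f1 b (by simp)
    obtain ⟨c1, c2, c3⟩ := f1 c (by simp)
    obtain ⟨d1, d2, d3⟩ := f1 d (by simp)
    refine caseA hΨ hpos hβ a2 b2 c2 d2 (ho a a1 b b1 hab) (ho a a1 c c1 hac)
      (ho a a1 d d1 had) (ho b b1 c c1 hbc) (ho b b1 d d1 hbd) (ho c c1 d d1 hcd)
      a3 b3 c3 d3 ?_
    rw [hdec, Finset.sum_empty, add_zero, Finset.sum_insert (by simp [hab, hac, had]),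
      Finset.sum_insert (by simp [hbc, hbd]), Finset.sum_insert (by simp [hcd]),
      Finset.sum_singleton]
    abel
  · obtain ⟨a, b, hab, rfl⟩ := Finset.card_eq_two.mp c1
    obtain ⟨c, rfl⟩ := Finset.card_eq_one.mp c2
    obtain ⟨a1, a2, a3⟩ := f1 a (by simp)
    obtain ⟨b1, b2, b3⟩ := f1 b (by simp)
    obtain ⟨c1, c2, c3, c4⟩ := f2 c (by simp)
    refine caseB hΨ hpos hβ a2 b2 c2 (ho a a1 b b1 hab)
      (ho a a1 c c1 (hdisj a (by simp) c (by simp)))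
      (ho b b1 c c1 (hdisj b (by simp) c (by simp))) a3 b3 c3 c4 ?_
    rw [hdec, Finset.sum_singleton, Finset.sum_pair hab]
  · obtain ⟨a, b, hab, rfl⟩ := Finset.card_eq_two.mp c2
    rw [Finset.card_eq_zero] at c1
    subst c1
    obtain ⟨a1, a2, a3, a4⟩ := f2 a (by simp)
    obtain ⟨b1, b2, b3, b4⟩ := f2 b (by simp)
    refine hadd a a1 b b1 hab ?_
    rw [Finset.sum_empty, zero_add, Finset.sum_pair hab, ← smul_add] at hdec
    have := smul_right_injective V (two_ne_zero (α := ℝ)) hdec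
    rwa [← this]

end RootSystemData

namespace LieRootData

variable {L : Type*} [LieRing L] [LieAlgebra ℂ L] (D : LieRootData V L)

/-- The filtration of `L` by degree. -/
def filt (φ : V →ₗ[ℝ] ℝ) (t : ℝ) : Submodule ℂ L :=
  (⨆ β ∈ {β | β ∈ D.roots ∧ t ≤ φ β}, D.rs β) ⊔ (⨆ _ : t ≤ 0, D.cartan.toSubmodule)

theorem rs_le_filt (φ : V →ₗ[ℝ] ℝ) (t : ℝ) {β : V} (hβ : β ∈ D.roots) (h : t ≤ φ β) :
    D.rs β ≤ D.filt φ t := by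
  refine le_trans ?_ le_sup_left
  exact le_iSup₂_of_le (f := fun β (_ : β ∈ {β | β ∈ D.roots ∧ t ≤ φ β}) => D.rs β)
    β ⟨hβ, h⟩ le_rfl

theorem cartan_le_filt (φ : V →ₗ[ℝ] ℝ) (t : ℝ) (h : t ≤ 0) :
    D.cartan.toSubmodule ≤ D.filt φ t :=
  le_trans (le_iSup_of_le h le_rfl) le_sup_right

theorem ad_filt (φ : V →ₗ[ℝ] ℝ) (Γ : Set V) (hΓ : Γ ⊆ D.roots) (hφ : ∀ γ ∈ Γ, φ γ = 2)
    {x : L} (hx : x ∈ D.aSubspace Γ) (t : ℝ) {y : L} (hy : y ∈ D.filt φ t) :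
    ⁅x, y⁆ ∈ D.filt φ (t + 2) := by
  have main : ∀ γ ∈ Γ, ∀ e ∈ D.rs γ, D.filt φ t ≤
      (D.filt φ (t + 2)).comap (LieAlgebra.ad ℂ L e : L →ₗ[ℂ] L) := by
    intro γ hγ e he
    have hγr := hΓ hγ
    refine sup_le (iSup₂_le ?_) (iSup_le ?_)
    · rintro β ⟨hβ, hb⟩ z hz
      rw [Submodule.mem_comap, LieAlgebra.ad_apply]
      have hdeg : φ (γ + β) = 2 + φ β := by rw [map_add, hφ γ hγ]
      by_cases h1 : γ + β ∈ D.roots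
      · exact D.rs_le_filt φ _ h1 (by linarith) (D.bracket_mem γ hγr β hβ h1 e he z hz)
      · by_cases h2 : γ + β = 0
        · have h3 : β = -γ := (neg_eq_of_add_eq_zero_right h2).symm
          refine D.cartan_le_filt φ _ ?_ ?_
          · rw [h2, map_zero] at hdeg
            linarith
          · exact D.bracket_cartan_mem γ hγr e he z (h3 ▸ hz)
        · rw [D.bracket_eq_zero γ hγr β hβ h1 h2 e he z hz]
          exact Submodule.zero_mem _
    · intro ht z hz
      rw [Submodule.mem_comap, LieAlgebra.ad_apply]
      obtain ⟨c, hc⟩ := D.weight_vec γ hγr z hz e he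
      rw [← lie_skew, hc]
      refine D.rs_le_filt φ _ hγr (by rw [hφ γ hγ]; linarith) ?_
      exact Submodule.neg_mem _ (Submodule.smul_mem _ _ he)
  have h2 : D.aSubspace Γ ≤
      (D.filt φ (t + 2)).comap ((LieAlgebra.ad ℂ L : L →ₗ[ℂ] Module.End ℂ L).flip y) := by
    refine iSup₂_le fun γ hγ e he => ?_
    exact main γ hγ e he hy
  exact h2 hx

theorem ad_pow_four (φ : V →ₗ[ℝ] ℝ) (Γ : Set V) (hΓ : Γ ⊆ D.roots) (hφ : ∀ γ ∈ Γ, φ γ = 2)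
    (hb : ∀ β ∈ D.roots, φ β < 4) {x : L} (hx : x ∈ D.aSubspace Γ) :
    (LieAlgebra.ad ℂ L x) ^ 4 = 0 := by
  have hb' : ∀ β ∈ D.roots, -4 < φ β := by
    intro β hβ
    have := hb (-β) (D.toRootSystemData.neg_mem hβ)
    rw [map_neg] at this
    linarith
  have htop : D.filt φ (-4) = ⊤ := by
    rw [eq_top_iff, ← D.sup_eq_top]
    refine sup_le (D.cartan_le_filt φ _ (by norm_num)) (iSup₂_le fun β hβ => ?_)
    exact D.rs_le_filt φ _ hβ (hb' β hβ).le
  have hbot : D.filt φ 4 = ⊥ := by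
    rw [eq_bot_iff]
    refine sup_le (iSup₂_le ?_) (iSup_le ?_)
    · rintro β ⟨hβ, h⟩
      exact absurd (hb β hβ) (not_lt.mpr h)
    · intro h
      norm_num at h
  ext y
  have h0 : y ∈ D.filt φ (-4) := by rw [htop]; trivial
  have h1 := D.ad_filt φ Γ hΓ hφ hx _ h0
  have h2 := D.ad_filt φ Γ hΓ hφ hx _ h1
  have h3 := D.ad_filt φ Γ hΓ hφ hx _ h2
  have h4 := D.ad_filt φ Γ hΓ hφ hx _ h3
  norm_num at h4
  rw [hbot, Submodule.mem_bot] at h4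
  simpa [pow_succ] using h4

/-- The functional `v ↦ ∑ ⟨v, γ⟩`. -/
def degFun (s : Finset V) : V →ₗ[ℝ] ℝ :=
  ∑ γ ∈ s, (2 / ⟪γ, γ⟫) • (innerSL ℝ γ).toLinearMap

theorem degFun_apply (s : Finset V) (v : V) : degFun s v = ∑ γ ∈ s, cpair v γ := by
  simp only [degFun, LinearMap.sum_apply, LinearMap.smul_apply, smul_eq_mul,
    ContinuousLinearMap.coe_coe, innerSL_apply_apply]
  refine Finset.sum_congr rfl fun γ _ => ?_
  rw [cpair, real_inner_comm v γ]
  ring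

theorem cpair_self {α : V} (h : α ∈ D.roots) : cpair α α = 2 := by
  have := D.toRootSystemData.inner_pos_of_root h
  unfold cpair
  field_simp

theorem cpair_lt_four {α β : V} (ha : α ∈ D.roots) (hb : β ∈ D.roots) : cpair β α < 4 := by
  by_contra hcon
  push Not at hcon
  have pa := D.toRootSystemData.inner_pos_of_root ha
  have pb := D.toRootSystemData.inner_pos_of_root hb
  obtain ⟨n, hn⟩ := D.crystallographic β hb α ha
  obtain ⟨m, hm⟩ := D.crystallographic α ha β hb
  rw [hn] at hcon
  unfold cpair at hn hm
  rw [div_eq_iff pa.ne'] at hn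
  rw [div_eq_iff pb.ne', real_inner_comm] at hm
  have hm0 : (0 : ℝ) < m := by
    by_contra hc
    push Not at hc
    nlinarith
  have hm1 : (1 : ℝ) ≤ m := by
    have : 0 < m := by exact_mod_cast hm0
    exact_mod_cast this
  have hcs := real_inner_mul_inner_self_le β α
  have h1 : ⟪β, β⟫ ≤ n * ⟪α, α⟫ := by nlinarith
  have h2 : (n : ℝ) ^ 2 * ⟪α, α⟫ ≤ 4 * ⟪β, β⟫ := by
    have : ⟪α, α⟫ * ((n : ℝ) ^ 2 * ⟪α, α⟫) ≤ ⟪α, α⟫ * (4 * ⟪β, β⟫) := by nlinarith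
    exact le_of_mul_le_mul_left this pa
  have h3 : (n : ℝ) ≤ 4 := by
    by_contra hc
    push Not at hc
    have : (n : ℝ) * ⟪α, α⟫ * (n - 4) > 0 := mul_pos (mul_pos (by linarith) pa) (by linarith)
    nlinarith
  have h4 : (n : ℝ) = 4 := le_antisymm h3 hcon
  rw [h4] at hn h1 h2
  have h0 : ⟪β - (2 : ℝ) • α, β - (2 : ℝ) • α⟫ = 0 := by
    rw [inner_sub_left, inner_sub_right, inner_sub_right, real_inner_smul_left,
      real_inner_smul_right, real_inner_smul_right, real_inner_smul_left,
      real_inner_comm β α]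
    linarith
  have h5 := sub_eq_zero.mp (inner_self_eq_zero.mp h0)
  rw [h5] at hb
  rcases D.reduced α ha 2 hb with h | h <;> norm_num at h

theorem ad_root_pow_four {α : V} (ha : α ∈ D.roots) {e : L} (he : e ∈ D.rs α) :
    (LieAlgebra.ad ℂ L e) ^ 4 = 0 := by
  refine D.ad_pow_four (degFun {α}) {α} (by simpa using ha) ?_ ?_ (x := e) ?_
  · intro γ hγ
    rw [Set.mem_singleton_iff] at hγ
    rw [degFun_apply, Finset.sum_singleton, hγ, D.cpair_self ha]
  · intro β hβ
    rw [degFun_apply, Finset.sum_singleton]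
    exact D.cpair_lt_four ha hβ
  · simpa [aSubspace] using he

/-- Conjugating `x` by the exponential of an ad-nilpotent `e` with `[e,[e,x]] = 0`. -/
theorem conj_pow_four {L : Type*} [LieRing L] [LieAlgebra ℂ L] (e x : L)
    (he : (LieAlgebra.ad ℂ L e) ^ 4 = 0)
    (h2 : ⁅e, ⁅e, x⁆⁆ = 0) (h : (LieAlgebra.ad ℂ L (x + ⁅e, x⁆)) ^ 4 = 0) :
    (LieAlgebra.ad ℂ L x) ^ 4 = 0 := by
  let : Module ℚ L := Module.compHom L (algebraMap ℚ ℂ)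
  let : LieAlgebra ℚ L :=
    { lie_smul := fun t a b => lie_smul (algebraMap ℚ ℂ t) a b }
  have hn : IsNilpotent (LieDerivation.ad ℂ L e).toLinearMap := by
    have e0 : (LieDerivation.ad ℂ L e).toLinearMap = LieAlgebra.ad ℂ L e := by
      ext y
      simp
    exact ⟨4, by rw [e0, he]⟩
  set Φ := LieDerivation.exp (LieDerivation.ad ℂ L e) hn with hΦ
  have hx : Φ x = x + ⁅e, x⁆ := by
    have h3 : ((LieDerivation.ad ℂ L e).toLinearMap ^ 2) • x = 0 := by
      simpa [pow_two] using h2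
    rw [hΦ, LieDerivation.exp_map_apply]
    have := IsNilpotent.exp_smul_eq_sum h3 hn
    simpa [Finset.sum_range_succ] using this
  have key : ∀ y, Φ (((LieAlgebra.ad ℂ L x) ^ 4) y) =
      ((LieAlgebra.ad ℂ L (x + ⁅e, x⁆)) ^ 4) (Φ y) := by
    intro y
    simp only [pow_succ, pow_zero, one_mul, Module.End.mul_apply, LieAlgebra.ad_apply,
      LieEquiv.map_lie, hx]
  ext y
  have := key y
  rw [h] at this
  simpa using this

theorem aSubspace_insert (a : V) (S : Set V) :
    D.aSubspace (insert a S) = D.rs a ⊔ D.aSubspace S := by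
  simp only [aSubspace]
  exact iSup_insert

theorem aSubspace_mono {S T : Set V} (h : S ⊆ T) : D.aSubspace S ≤ D.aSubspace T :=
  biSup_mono h

/-- The reduction step. -/
theorem reduce_step {a b : V} {S : Set V} (ha : a ∈ D.roots) (hb : b ∈ D.roots)
    (hS : S ⊆ D.roots) (hab : ⟪a, b⟫ = 0) (haS : ∀ γ ∈ S, ⟪a, γ⟫ = 0)
    (hbS : ∀ γ ∈ S, ⟪b, γ⟫ = 0) (hadd : a + b ∈ D.roots)
    (h1 : IsSphericalSubspace (D.aSubspace (insert a S)))
    (h2 : IsSphericalSubspace (D.aSubspace (insert b S))) :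
    IsSphericalSubspace (D.aSubspace (insert a (insert b S))) := by
  have pa := D.toRootSystemData.inner_pos_of_root ha
  have pb := D.toRootSystemData.inner_pos_of_root hb
  have hba := (real_inner_comm a b).trans hab
  have hnorm : ⟪a, a⟫ = ⟪b, b⟫ := by
    rcases lt_trichotomy ⟪a, a⟫ ⟪b, b⟫ with h | h | h
    · exact absurd hadd (D.toRootSystemData.not_root ha
        (by rw [inner_add_right, hab]; linarith)
        (by simp only [inner_add_right, inner_add_left, hab, hba]; linarith))
    · exact h
    · exact absurd hadd (D.toRootSystemData.not_root hb
        (by rw [inner_add_right, hba]; linarith)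
        (by simp only [inner_add_right, inner_add_left, hab, hba]; linarith))
  have hdiff : b - a ∈ D.roots := by
    have := D.toRootSystemData.refl_mem' hadd ha 2 (by rw [inner_add_left, hba]; ring)
    have e : a + b - (2 : ℝ) • a = b - a := by module
    rwa [e] at this
  have hnot : ∀ γ ∈ insert b S, ∀ e ∈ D.rs (b - a), ∀ z ∈ D.rs γ, ⁅e, z⁆ = 0 := by
    intro γ hγ e he z hz
    have hγr : γ ∈ D.roots := by
      rcases hγ with rfl | hγ
      · exact hb
      · exact hS hγ
    have pγ := D.toRootSystemData.inner_pos_of_root hγr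
    have hi : 0 < ⟪a, -(b - a + γ)⟫ ∧ 2 * ⟪a, -(b - a + γ)⟫ < ⟪-(b - a + γ), -(b - a + γ)⟫ := by
      have haγ : ⟪a, γ⟫ = 0 := by
        rcases hγ with rfl | hγ
        · exact hab
        · exact haS γ hγ
      have hγa := (real_inner_comm a γ).trans haγ
      have hbγ : 0 ≤ ⟪b, γ⟫ := by
        rcases hγ with rfl | hγ
        · exact pb.le
        · exact (hbS γ hγ).ge
      have hγb := real_inner_comm b γ
      rw [inner_neg_neg]
      simp only [inner_neg_right, inner_add_right, inner_add_left, inner_sub_left,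
        inner_sub_right, hab, hba, haγ, hγa, hγb]
      constructor <;> linarith
    have hnr : b - a + γ ∉ D.roots := by
      intro h
      exact D.toRootSystemData.not_root ha hi.1 hi.2 (D.toRootSystemData.neg_mem h)
    have hne : b - a + γ ≠ 0 := by
      intro h
      have := hi.1
      rw [h] at this
      simp at this
    exact D.bracket_eq_zero _ hdiff γ hγr hnr hne e he z hz
  have hnot' : ∀ e ∈ D.rs (b - a), ∀ z ∈ D.aSubspace (insert b S), ⁅e, z⁆ = 0 := by
    intro e he z hz
    have : D.aSubspace (insert b S) ≤ LinearMap.ker (LieAlgebra.ad ℂ L e : L →ₗ[ℂ] L) :=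
      iSup₂_le fun γ hγ z hz => hnot γ hγ e he z hz
    exact this hz
  intro x hx
  rw [aSubspace_insert] at hx
  obtain ⟨u, hu, y, hy, rfl⟩ := Submodule.mem_sup.mp hx
  have hy' := hy
  rw [aSubspace_insert] at hy
  obtain ⟨v, hv, z, hz, rfl⟩ := Submodule.mem_sup.mp hy
  by_cases hu0 : u = 0
  · rw [hu0, zero_add]
    exact h2 _ hy'
  have := D.rs_dim _ hdiff
  obtain ⟨⟨e, he⟩, hne, -⟩ := finrank_eq_one_iff'.mp this
  have hne' : e ≠ 0 := fun h => hne (by simp [h])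
  have hsum : b - a + a = b := by abel
  have hw : ⁅e, u⁆ ∈ D.rs b := by
    have := D.bracket_mem _ hdiff a ha (by rwa [hsum]) e he u hu
    rwa [hsum] at this
  have hw0 : ⁅e, u⁆ ≠ 0 :=
    D.bracket_ne_zero _ hdiff a ha (by rwa [hsum]) e he hne' u hu hu0
  obtain ⟨c, hc⟩ := (finrank_eq_one_iff_of_nonzero' (⟨⁅e, u⁆, hw⟩ : D.rs b)
    (fun h => hw0 (congrArg Subtype.val h))).mp (D.rs_dim b hb) ⟨v, hv⟩
  have hc' : c • ⁅e, u⁆ = v := congrArg Subtype.val hc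
  have he' : (-c) • e ∈ D.rs (b - a) := Submodule.smul_mem _ _ he
  have hbr : ⁅(-c) • e, u + (v + z)⁆ = -v := by
    rw [lie_add, hnot' _ he' _ hy', add_zero, smul_lie, neg_smul, hc']
  refine conj_pow_four ((-c) • e) _ (D.ad_root_pow_four hdiff he') ?_ ?_
  · rw [hbr, lie_neg, hnot b (Set.mem_insert _ _) _ he' v hv, neg_zero]
  · rw [hbr]
    have : u + (v + z) + -v = u + z := by abel
    rw [this]
    refine h1 _ ?_
    rw [aSubspace_insert]
    exact Submodule.add_mem_sup hu hz

end LieRootData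

end Helpers2

/-- Suppose `Φ` is irreducible and not of type `G₂`. Let
`Ψ ⊆ Φ⁺` be either a combinatorial ideal or a biconvex subset with `⟨α, β⟩ ≥ 0`
for all `α, β ∈ Ψ`, and let `Γ ⊆ Ψ` be an orthogonal subset. Then
`𝔞_Γ = ⊕_{γ ∈ Γ} 𝔤_γ` is a spherical subspace of `𝔫`. -/
theorem orthogonal_subset_spherical
    {V : Type*} [NormedAddCommGroup V] [InnerProductSpace ℝ V]
    {L : Type*} [LieRing L] [LieAlgebra ℂ L]
    (D : LieRootData V L)
    (hirr : D.toRootSystemData.IsIrreducible)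
    (hG2 : D.toRootSystemData.NotG2)
    (Ψ : Set V)
    (hΨ : D.toRootSystemData.CombIdeal Ψ ∨ D.toRootSystemData.Biconvex Ψ)
    (hpos : ∀ α ∈ Ψ, ∀ β ∈ Ψ, 0 ≤ cpair α β)
    (Γ : Set V) (hΓΨ : Γ ⊆ Ψ) (horth : OrthogonalSet Γ) :
    IsSphericalSubspace (D.aSubspace Γ) := by
  classical
  have _ := hirr
  have hΓr : Γ ⊆ D.roots := fun γ h => RootSystemData.psi_root hΨ (hΓΨ h)
  have ho : ∀ γ ∈ Γ, ∀ γ' ∈ Γ, γ ≠ γ' → ⟪γ, γ'⟫ = 0 := by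
    intro γ hγ γ' hγ' hne
    have h := horth γ hγ γ' hγ' hne
    have hp := D.toRootSystemData.inner_pos_of_root (hΓr hγ')
    unfold cpair at h
    rw [div_eq_zero_iff] at h
    rcases h with h | h <;> linarith
  have main : ∀ s : Finset V, (s : Set V) ⊆ Γ → IsSphericalSubspace (D.aSubspace (s : Set V)) := by
    intro s
    induction s using Finset.strongInduction with
    | H s ih =>
      intro hs
      by_cases hadd : ∃ a ∈ s, ∃ b ∈ s, a ≠ b ∧ a + b ∈ D.roots
      · obtain ⟨a, ha, b, hb, hne, hab⟩ := hadd
        have hab' := ho a (hs ha) b (hs hb) hne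
        have hSr : (((s.erase a).erase b : Finset V) : Set V) ⊆ Γ := by
          intro γ hγ
          simp only [Finset.coe_erase, Set.mem_sdiff] at hγ
          exact hs hγ.1.1
        have e1 : insert a ((s.erase a).erase b) = s.erase b := by
          rw [Finset.erase_right_comm, Finset.insert_erase]
          exact Finset.mem_erase.mpr ⟨hne, ha⟩
        have e2 : insert b ((s.erase a).erase b) = s.erase a :=
          Finset.insert_erase (Finset.mem_erase.mpr ⟨hne.symm, hb⟩)
        have e3 : insert a (insert b ((s.erase a).erase b)) = s := by
          rw [e2, Finset.insert_erase ha]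
        have i1 := ih (s.erase b) (Finset.erase_ssubset hb)
          (fun γ h => hs (Finset.mem_of_mem_erase h))
        have i2 := ih (s.erase a) (Finset.erase_ssubset ha)
          (fun γ h => hs (Finset.mem_of_mem_erase h))
        rw [← e1, Finset.coe_insert] at i1
        rw [← e2, Finset.coe_insert] at i2
        have hm : ∀ γ ∈ (((s.erase a).erase b : Finset V) : Set V), γ ≠ b ∧ γ ≠ a := by
          intro γ hγ
          have h := Finset.mem_erase.mp hγ
          exact ⟨h.1, (Finset.mem_erase.mp h.2).1⟩
        have := D.reduce_step (hΓr (hs ha)) (hΓr (hs hb)) (hSr.trans hΓr) hab'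
          (fun γ hγ => ho a (hs ha) γ (hSr hγ) (hm γ hγ).2.symm)
          (fun γ hγ => ho b (hs hb) γ (hSr hγ) (hm γ hγ).1.symm) hab i1 i2
        rw [← Finset.coe_insert, ← Finset.coe_insert, e3] at this
        exact this
      · push Not at hadd
        intro x hx
        refine D.ad_pow_four (LieRootData.degFun s) (s : Set V) (hs.trans hΓr) ?_ ?_ hx
        · intro γ hγ
          rw [LieRootData.degFun_apply, Finset.sum_eq_single γ]
          · exact D.cpair_self (hΓr (hs hγ))
          · intro γ' hγ' hne
            exact horth γ (hs hγ) γ' (hs hγ') hne.symm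
          · intro h
            exact absurd hγ h
        · intro β hβ
          rw [LieRootData.degFun_apply]
          exact RootSystemData.degree_lt hG2 hΨ hpos s (fun γ h => hΓΨ (hs h))
            (fun γ h γ' h' => ho γ (hs h) γ' (hs h')) hadd hβ
  have hfin : Γ.Finite := D.finite.subset hΓr
  have := main hfin.toFinset (by simp)
  simpa using this
end
end

section
/- Suppose Φ is doubly laced. Let γ₁, γ₂, γ₃, γ₄ ∈ Φ⁺ be (not necessarily distinct) short roots such that ⟨γ_i,γ_j⟩ ≥ 0 for all i,j, assume Γ = {γ₁,γ₂,γ₃,γ₄} is not orthogonal, and assume ½(γ₁+γ₂+γ₃+γ₄) ∈ Φ. Then, up to reordering, γ₁+γ₂ = γ₃+γ₄; moreover 𝔞_Γ = ⊕_{γ∈Γ} 𝔤_γ is a spherical subspace of 𝔫, i.e. ad(x)⁴ = 0 for every x ∈ 𝔞_Γ. -/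
/- Background setup: a finite reduced crystallographic root system `Φ` with chosen
positive roots `Φ⁺` in a euclidean space `V`, the Cartan pairing, and the basic
combinatorial notions used in the statement. -/

open scoped RealInnerProductSpace

noncomputable section

variable {V : Type*} [NormedAddCommGroup V] [InnerProductSpace ℝ V]

structure Quad {V : Type*} [NormedAddCommGroup V] [InnerProductSpace ℝ V]
    (D : RootSystemData V) (u : ℝ) (a b c d : V) : Prop where
  u_pos : 0 < u
  ha : a ∈ D.roots
  hb : b ∈ D.roots
  hc : c ∈ D.roots
  hd : d ∈ D.roots
  aa : ⟪a, a⟫ = 2 * u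
  bb : ⟪b, b⟫ = 2 * u
  cc : ⟪c, c⟫ = 2 * u
  dd : ⟪d, d⟫ = 2 * u
  ab : ⟪a, b⟫ = 0
  cd : ⟪c, d⟫ = 0
  ac : ⟪a, c⟫ = u
  ad : ⟪a, d⟫ = u
  bc : ⟪b, c⟫ = u
  bd : ⟪b, d⟫ = u
  hsum : a + b = c + d
  hδ : a + b ∈ D.roots
  hle : ∀ β ∈ D.roots, ⟪β, β⟫ ≤ 4 * u

section aux
variable {V : Type*} [NormedAddCommGroup V] [InnerProductSpace ℝ V]

lemma refl_apply' (β v : V) : reflEnd β v = v - (2 * ⟪β, v⟫ / ⟪β, β⟫) • β := by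
  simp only [reflEnd, LinearMap.sub_apply, LinearMap.id_apply, LinearMap.comp_apply,
    LinearMap.smul_apply, LinearMap.toSpanSingleton_apply]
  congr 2
  simp only [ContinuousLinearMap.coe_coe, innerSL_apply_apply, smul_eq_mul]
  ring

lemma neg_root (D : RootSystemData V) {a : V} (ha : a ∈ D.roots) : -a ∈ D.roots := by
  have h := D.reflect_mem a ha a ha
  rw [refl_apply'] at h
  have h0 : ⟪a, a⟫ ≠ 0 := by simpa using D.ne_zero a ha
  have : a - (2 * ⟪a, a⟫ / ⟪a, a⟫) • a = -a := by
    rw [mul_div_assoc, div_self h0, mul_one, two_smul]; abel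
  rwa [this] at h

variable {D : RootSystemData V} {u : ℝ} {a b c d : V}

lemma Quad.swap (h : Quad D u a b c d) : Quad D u b a c d := by
  obtain ⟨h1, ha, hb, hc, hd, aa, bb, cc, dd, ab, cd, ac, ad, bc, bd, hs, hδ, hle⟩ := h
  refine ⟨h1, hb, ha, hc, hd, bb, aa, cc, dd, ?_, cd, bc, bd, ac, ad, ?_, ?_, hle⟩
  · rw [real_inner_comm]; exact ab
  · rw [add_comm]; exact hs
  · rw [add_comm]; exact hδ

lemma Quad.flip (h : Quad D u a b c d) : Quad D u c d a b := by
  obtain ⟨h1, ha, hb, hc, hd, aa, bb, cc, dd, ab, cd, ac, ad, bc, bd, hs, hδ, hle⟩ := h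
  refine ⟨h1, hc, hd, ha, hb, cc, dd, aa, bb, cd, ab, ?_, ?_, ?_, ?_, hs.symm, hs ▸ hδ, hle⟩
  all_goals rw [real_inner_comm]; assumption

lemma Quad.swap' (h : Quad D u a b c d) : Quad D u a b d c := h.flip.swap.flip

lemma Quad.sub_root (h : Quad D u a b c d) : b - a ∈ D.roots := by
  have := D.reflect_mem _ h.hδ _ h.ha
  rw [refl_apply'] at this
  have e : (2 * ⟪a, a + b⟫ / ⟪a, a⟫) = 2 := by
    rw [inner_add_right, h.aa, h.ab]; have := h.u_pos; field_simp; ring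
  rw [e, two_smul] at this
  convert this using 1; abel

lemma Quad.sub_root' (h : Quad D u a b c d) : c - a ∈ D.roots := by
  have := D.reflect_mem _ h.hc _ h.ha
  rw [refl_apply'] at this
  have e : (2 * ⟪a, c⟫ / ⟪a, a⟫) = 1 := by
    rw [h.ac, h.aa]; have := h.u_pos; field_simp
  rwa [e, one_smul] at this

/-- A combination of `a, b, c` of large norm is not a root and is nonzero. -/
lemma Quad.nonroot (h : Quad D u a b c d) (x y z : ℝ) (v : V)
    (hv : v = x • a + y • b + z • c)
    (hn : 4 < 2 * x ^ 2 + 2 * y ^ 2 + 2 * z ^ 2 + 2 * x * z + 2 * y * z) :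
    v ∉ D.roots ∧ v ≠ 0 := by
  have hu := h.u_pos
  have key : ⟪v, v⟫ = (2 * x ^ 2 + 2 * y ^ 2 + 2 * z ^ 2 + 2 * x * z + 2 * y * z) * u := by
    have e1 : ⟪b, a⟫ = 0 := by rw [real_inner_comm]; exact h.ab
    have e2 : ⟪c, a⟫ = u := by rw [real_inner_comm]; exact h.ac
    have e3 : ⟪c, b⟫ = u := by rw [real_inner_comm]; exact h.bc
    subst hv
    simp only [inner_add_left, inner_add_right, inner_smul_left, inner_smul_right, h.aa, h.bb, h.cc,
      h.ab, h.ac, h.bc, e1, e2, e3]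
    simp
    ring
  constructor
  · intro hr
    have := h.hle v hr
    rw [key] at this
    nlinarith
  · intro h0
    rw [h0, inner_zero_left] at key
    nlinarith

end aux

section lie
variable {V : Type*} [NormedAddCommGroup V] [InnerProductSpace ℝ V]
variable {L : Type*} [LieRing L] [LieAlgebra ℂ L] {D : LieRootData V L}

lemma rs_exists_ne (D : LieRootData V L) {α : V} (hα : α ∈ D.roots) :
    ∃ x ∈ D.rs α, x ≠ 0 := by
  have h := D.rs_dim α hα
  have : Nontrivial (D.rs α) := Module.nontrivial_of_finrank_pos (R := ℂ) (by omega)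
  obtain ⟨x, hx⟩ := exists_ne (0 : D.rs α)
  exact ⟨x, x.2, by simpa using hx⟩

lemma rs_smul (D : LieRootData V L) {α : V} (hα : α ∈ D.roots) {x y : L}
    (hx : x ∈ D.rs α) (hx0 : x ≠ 0) (hy : y ∈ D.rs α) : ∃ t : ℂ, t • x = y := by
  have h := D.rs_dim α hα
  obtain ⟨t, ht⟩ := (finrank_eq_one_iff_of_nonzero' (⟨x, hx⟩ : D.rs α)
    (by simpa using hx0)).1 h ⟨y, hy⟩
  exact ⟨t, by simpa using congrArg Subtype.val ht⟩

/-- Solve `[w, x] = y`. -/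
lemma rs_solve (D : LieRootData V L) {α β : V} (hα : α ∈ D.roots) (hβ : β ∈ D.roots)
    (hs : α - β ∈ D.roots) {x y : L} (hx : x ∈ D.rs β) (hx0 : x ≠ 0) (hy : y ∈ D.rs α) :
    ∃ w ∈ D.rs (α - β), ⁅w, x⁆ = y := by
  obtain ⟨w, hw, hw0⟩ := rs_exists_ne D hs
  have e : α - β + β = α := sub_add_cancel _ _
  have h1 := D.bracket_mem _ hs _ hβ (by rwa [e]) w hw x hx
  have h2 := D.bracket_ne_zero _ hs _ hβ (by rwa [e]) w hw hw0 x hx hx0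
  rw [e] at h1
  obtain ⟨t, ht⟩ := rs_smul D hα h1 h2 hy
  exact ⟨t • w, Submodule.smul_mem _ _ hw, by rw [smul_lie, ht]⟩

lemma Quad.exists_z {u : ℝ} {a b c d : V} (h : Quad D.toRootSystemData u a b c d)
    {x1 x2 x3 x4 : L} (h1 : x1 ∈ D.rs a) (h2 : x2 ∈ D.rs b) (h3 : x3 ∈ D.rs c)
    (h4 : x4 ∈ D.rs d) (h0 : x1 ≠ 0) :
    ∃ z : L, ⁅z, x1 + x2 + x3 + x4⁆ = x1 + x2 + x3 + x4 ∧
      (∀ y ∈ D.rs (a + b), ⁅z, y⁆ = 0) ∧ (∀ y ∈ D.rs (-(a + b)), ⁅z, y⁆ = 0) := by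
  have hdd : d = a + b - c := by rw [h.hsum]; abel
  have hba := h.sub_root
  have hab := h.swap.sub_root
  have hca := h.sub_root'
  have hda := h.swap'.sub_root'
  have hδ := h.hδ
  have hnδ := neg_root _ hδ
  have kill : ∀ α ∈ D.roots, ∀ β ∈ D.roots, ∀ x y z : ℝ, α + β = x • a + y • b + z • c →
      4 < 2 * x ^ 2 + 2 * y ^ 2 + 2 * z ^ 2 + 2 * x * z + 2 * y * z →
      ∀ p ∈ D.rs α, ∀ q ∈ D.rs β, ⁅p, q⁆ = 0 := by
    intro α hα β hβ x y z hv hn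
    have := h.nonroot x y z _ hv hn
    exact D.bracket_eq_zero α hα β hβ this.1 this.2
  -- the Cartan part
  obtain ⟨q, hq, hq0⟩ := rs_exists_ne D hba
  have e1 : b - a + a = b := sub_add_cancel _ _
  have hqx := D.bracket_mem _ hba _ h.ha (by rw [e1]; exact h.hb) q hq x1 h1
  have hqx0 := D.bracket_ne_zero _ hba _ h.ha (by rw [e1]; exact h.hb) q hq hq0 x1 h1 h0
  rw [e1] at hqx
  obtain ⟨p, hp, hpx⟩ := rs_solve D h.ha h.hb hab hqx hqx0 h1
  have e2 : a - b + b = a := sub_add_cancel _ _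
  have hH1 : ⁅⁅p, q⁆, x1⁆ = x1 := by
    rw [lie_lie, hpx, kill _ hab _ h.ha 2 (-1) 0 (by module) (by norm_num) p hp x1 h1]
    simp
  have hH2 : ⁅⁅p, q⁆, x2⁆ ∈ D.rs b := by
    rw [lie_lie, kill _ hba _ h.hb (-1) 2 0 (by module) (by norm_num) q hq x2 h2]
    have m1 := D.bracket_mem _ hab _ h.hb (by rw [e2]; exact h.ha) p hp x2 h2
    rw [e2] at m1
    have m2 := D.bracket_mem _ hba _ h.ha (by rw [e1]; exact h.hb) q hq _ m1
    rw [e1] at m2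
    rw [lie_zero, zero_sub]
    exact neg_mem m2
  have hH3 : ⁅⁅p, q⁆, x3⁆ = 0 := by
    rw [lie_lie, kill _ hab _ h.hc 1 (-1) 1 (by module) (by norm_num) p hp x3 h3,
      kill _ hba _ h.hc (-1) 1 1 (by module) (by norm_num) q hq x3 h3]
    simp
  have hH4 : ⁅⁅p, q⁆, x4⁆ = 0 := by
    rw [lie_lie, kill _ hab _ h.hd 2 0 (-1) (by rw [hdd]; module) (by norm_num) p hp x4 h4,
      kill _ hba _ h.hd 0 2 (-1) (by rw [hdd]; module) (by norm_num) q hq x4 h4]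
    simp
  obtain ⟨w, hw, hwx⟩ := rs_solve D h.hc h.ha hca h1 h0 h3
  obtain ⟨v, hv, hvx⟩ := rs_solve D h.hd h.ha hda h1 h0 h4
  have ew : c - a + d = b := by rw [hdd]; abel
  have ev : d - a + c = b := by rw [hdd]; abel
  have hw2 := kill _ hca _ h.hb (-1) 1 1 (by module) (by norm_num) w hw x2 h2
  have hw3 := kill _ hca _ h.hc (-1) 0 2 (by module) (by norm_num) w hw x3 h3
  have hw4 := D.bracket_mem _ hca _ h.hd (by rw [ew]; exact h.hb) w hw x4 h4
  have hv2 := kill _ hda _ h.hb 0 2 (-1) (by rw [hdd]; module) (by norm_num) v hv x2 h2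
  have hv3 := D.bracket_mem _ hda _ h.hc (by rw [ev]; exact h.hb) v hv x3 h3
  have hv4 := kill _ hda _ h.hd 1 2 (-2) (by rw [hdd]; module) (by norm_num) v hv x4 h4
  rw [ew] at hw4
  rw [ev] at hv3
  obtain ⟨r, hr, hrx⟩ := rs_solve D h.hb h.ha hba h1 h0
    (sub_mem (sub_mem (sub_mem h2 hH2) hw4) hv3)
  have hr2 := kill _ hba _ h.hb (-1) 2 0 (by module) (by norm_num) r hr x2 h2
  have hr3 := kill _ hba _ h.hc (-1) 1 1 (by module) (by norm_num) r hr x3 h3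
  have hr4 := kill _ hba _ h.hd 0 2 (-1) (by rw [hdd]; module) (by norm_num) r hr x4 h4
  refine ⟨⁅p, q⁆ + w + v + r, ?_, ?_, ?_⟩
  · simp only [add_lie, lie_add, hH1, hH3, hH4, hwx, hw2, hw3, hvx, hv2, hv4, hrx, hr2, hr3, hr4]
    abel
  · intro y hy
    simp only [add_lie, lie_lie,
      kill _ hab _ hδ 2 0 0 (by module) (by norm_num) p hp y hy,
      kill _ hba _ hδ 0 2 0 (by module) (by norm_num) q hq y hy,
      kill _ hba _ hδ 0 2 0 (by module) (by norm_num) r hr y hy,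
      kill _ hca _ hδ 0 1 1 (by module) (by norm_num) w hw y hy,
      kill _ hda _ hδ 1 2 (-1) (by rw [hdd]; module) (by norm_num) v hv y hy]
    simp
  · intro y hy
    simp only [add_lie, lie_lie,
      kill _ hab _ hnδ 0 (-2) 0 (by module) (by norm_num) p hp y hy,
      kill _ hba _ hnδ (-2) 0 0 (by module) (by norm_num) q hq y hy,
      kill _ hba _ hnδ (-2) 0 0 (by module) (by norm_num) r hr y hy,
      kill _ hca _ hnδ (-2) (-1) 1 (by module) (by norm_num) w hw y hy,
      kill _ hda _ hnδ (-1) 0 (-1) (by rw [hdd]; module) (by norm_num) v hv y hy]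
    simp

lemma Quad.exists_z' {u : ℝ} {a b c d : V} (h : Quad D.toRootSystemData u a b c d)
    {x1 x2 x3 x4 : L} (h1 : x1 ∈ D.rs a) (h2 : x2 ∈ D.rs b) (h3 : x3 ∈ D.rs c)
    (h4 : x4 ∈ D.rs d) :
    ∃ z : L, ⁅z, x1 + x2 + x3 + x4⁆ = x1 + x2 + x3 + x4 ∧
      (∀ y ∈ D.rs (a + b), ⁅z, y⁆ = 0) ∧ (∀ y ∈ D.rs (-(a + b)), ⁅z, y⁆ = 0) := by
  by_cases z1 : x1 = 0
  · by_cases z2 : x2 = 0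
    · by_cases z3 : x3 = 0
      · by_cases z4 : x4 = 0
        · exact ⟨0, by simp [z1, z2, z3, z4], by simp, by simp⟩
        · have := h.flip.swap.exists_z h4 h3 h1 h2 z4
          rw [show x4 + x3 + x1 + x2 = x1 + x2 + x3 + x4 by abel,
            show d + c = a + b by rw [h.hsum, add_comm]] at this
          exact this
      · have := h.flip.exists_z h3 h4 h1 h2 z3
        rw [show x3 + x4 + x1 + x2 = x1 + x2 + x3 + x4 by abel, ← h.hsum] at this
        exact this
    · have := h.swap.exists_z h2 h1 h3 h4 z2
      rw [show x2 + x1 + x3 + x4 = x1 + x2 + x3 + x4 by abel, add_comm b a] at this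
      exact this
  · exact h.exists_z h1 h2 h3 h4 z1

/-- The graded pieces with respect to the coroot of `δ`. -/
def gr (D : LieRootData V L) (δ : V) (m : ℝ) : Submodule ℂ L :=
  (⨆ (_ : m = 0), D.cartan.toSubmodule) ⊔ ⨆ β ∈ {β | β ∈ D.roots ∧ cpair β δ = m}, D.rs β

lemma rs_le_gr {δ β : V} {m : ℝ} (hβ : β ∈ D.roots) (hm : cpair β δ = m) :
    D.rs β ≤ gr D δ m :=
  le_sup_of_le_right (le_iSup₂_of_le (f := fun β (_ : β ∈ {β | β ∈ D.roots ∧ cpair β δ = m}) =>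
    D.rs β) β ⟨hβ, hm⟩ le_rfl)

lemma cartan_le_gr {δ : V} {m : ℝ} (hm : m = 0) : D.cartan.toSubmodule ≤ gr D δ m :=
  le_sup_of_le_left (le_iSup (fun (_ : m = 0) => D.cartan.toSubmodule) hm)

lemma gr_le {δ : V} {m : ℝ} {M : Submodule ℂ L} (h0 : m = 0 → D.cartan.toSubmodule ≤ M)
    (h1 : ∀ β ∈ D.roots, cpair β δ = m → D.rs β ≤ M) : gr D δ m ≤ M :=
  sup_le (iSup_le h0) (iSup₂_le fun β hβ => h1 β hβ.1 hβ.2)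

lemma cpair_add (α β δ : V) : cpair (α + β) δ = cpair α δ + cpair β δ := by
  simp only [cpair, inner_add_left]; ring

lemma lie_gr {δ γ : V} (hγ : γ ∈ D.roots) (h1 : cpair γ δ = 1) {x : L} (hx : x ∈ D.rs γ)
    (m : ℝ) : gr D δ m ≤ (gr D δ (m + 1)).comap (LieAlgebra.ad ℂ L x) := by
  apply gr_le
  · intro hm y hy
    obtain ⟨t, ht⟩ := D.weight_vec γ hγ y hy x hx
    rw [Submodule.mem_comap, LieAlgebra.ad_apply, ← lie_skew, ht]
    exact neg_mem (Submodule.smul_mem _ _ (rs_le_gr hγ (by rw [h1, hm, zero_add]) hx))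
  · intro β hβ hm y hy
    rw [Submodule.mem_comap, LieAlgebra.ad_apply]
    by_cases h : γ + β ∈ D.roots
    · exact rs_le_gr h (by rw [cpair_add, h1, hm, add_comm]) (D.bracket_mem _ hγ _ hβ h x hx y hy)
    · by_cases h' : γ + β = 0
      · have hb : β = -γ := (neg_eq_of_add_eq_zero_right h').symm
        have e := cpair_add γ β δ
        rw [h', h1, hm] at e
        refine cartan_le_gr ?_ (D.bracket_cartan_mem γ hγ x hx y (hb ▸ hy))
        rw [add_comm, ← e]; simp [cpair]
      · rw [D.bracket_eq_zero _ hγ _ hβ h h' x hx y hy]; exact zero_mem _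

lemma Quad.main {u : ℝ} {a b c d : V} (h : Quad D.toRootSystemData u a b c d)
    {x1 x2 x3 x4 : L} (h1 : x1 ∈ D.rs a) (h2 : x2 ∈ D.rs b) (h3 : x3 ∈ D.rs c)
    (h4 : x4 ∈ D.rs d) : (LieAlgebra.ad ℂ L (x1 + x2 + x3 + x4)) ^ 4 = 0 := by
  have hu := h.u_pos
  obtain ⟨z, hz, hzp, hzn⟩ := h.exists_z' h1 h2 h3 h4
  set x := x1 + x2 + x3 + x4 with hx
  set A := LieAlgebra.ad ℂ L x with hA
  set δ := a + b with hδ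
  have hba : ⟪b, a⟫ = 0 := by rw [real_inner_comm]; exact h.ab
  have dd : ⟪δ, δ⟫ = 4 * u := by
    rw [hδ]; simp only [inner_add_left, inner_add_right, h.aa, h.bb, h.ab, hba]; ring
  have ca : cpair a δ = 1 := by
    rw [cpair, dd, hδ]; simp only [inner_add_right, h.aa, h.ab]; field_simp; ring
  have cb : cpair b δ = 1 := by
    rw [cpair, dd, hδ]; simp only [inner_add_right, h.bb, hba]; field_simp; ring
  have cc : cpair c δ = 1 := by
    rw [cpair, dd, hδ, h.hsum]; simp only [inner_add_right, h.cc, h.cd]; field_simp; ring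
  have cd : cpair d δ = 1 := by
    have : ⟪d, c⟫ = 0 := by rw [real_inner_comm]; exact h.cd
    rw [cpair, dd, hδ, h.hsum]; simp only [inner_add_right, h.dd, this]; field_simp; ring
  have step : ∀ m : ℝ, ∀ y ∈ gr D δ m, A y ∈ gr D δ (m + 1) := by
    intro m y hy
    rw [hA, hx]
    simp only [map_add, LinearMap.add_apply]
    exact add_mem (add_mem (add_mem (lie_gr h.ha ca h1 m hy) (lie_gr h.hb cb h2 m hy))
      (lie_gr h.hc cc h3 m hy)) (lie_gr h.hd cd h4 m hy)
  have step4 : ∀ m : ℝ, ∀ y ∈ gr D δ m, (A ^ 4) y ∈ gr D δ (m + 4) := by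
    intro m y hy
    have := step _ _ (step _ _ (step _ _ (step _ _ hy)))
    rw [show m + 1 + 1 + 1 + 1 = m + 4 by ring] at this
    exact this
  -- norm expansions
  have bound : ∀ β ∈ D.roots, cpair β δ ≤ 2 ∧ -2 ≤ cpair β δ ∧
      (cpair β δ = 2 → β = δ) ∧ (cpair β δ = -2 → β = -δ) := by
    intro β hβ
    have hl := h.hle β hβ
    have e : cpair β δ = ⟪β, δ⟫ / (2 * u) := by rw [cpair, dd]; field_simp; ring
    have p1 : 0 ≤ ⟪β - δ, β - δ⟫ := real_inner_self_nonneg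
    have p2 : 0 ≤ ⟪β + δ, β + δ⟫ := real_inner_self_nonneg
    have q1 : ⟪β - δ, β - δ⟫ = ⟪β, β⟫ - 2 * ⟪β, δ⟫ + 4 * u := by
      rw [real_inner_sub_sub_self, dd]
    have q2 : ⟪β + δ, β + δ⟫ = ⟪β, β⟫ + 2 * ⟪β, δ⟫ + 4 * u := by
      rw [real_inner_add_add_self, dd]
    have e' : ⟪β, δ⟫ = cpair β δ * (2 * u) := by rw [e]; field_simp
    refine ⟨by nlinarith, by nlinarith, fun h2 => ?_, fun h2 => ?_⟩
    · have : ⟪β - δ, β - δ⟫ = 0 := by rw [h2] at e'; linarith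
      exact sub_eq_zero.1 (inner_self_eq_zero.1 this)
    · have : ⟪β + δ, β + δ⟫ = 0 := by rw [h2] at e'; linarith
      exact eq_neg_of_add_eq_zero_left (inner_self_eq_zero.1 this)
  have gr0 : ∀ m : ℝ, 2 < m → gr D δ m = ⊥ := by
    intro m hm
    rw [eq_bot_iff]
    refine gr_le (fun h => by linarith) fun β hβ h' => ?_
    have := (bound β hβ).1
    linarith
  have gr2 : gr D δ 2 ≤ D.rs δ :=
    gr_le (fun h => by norm_num at h) fun β hβ h' => by rw [(bound β hβ).2.2.1 h']
  have kill : ∀ m : ℝ, -2 < m → ∀ y ∈ gr D δ m, (A ^ 4) y = 0 := by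
    intro m hm y hy
    have := step4 m y hy
    rw [gr0 _ (by linarith)] at this
    simpa using this
  have key : (⊤ : Submodule ℂ L) ≤ LinearMap.ker (A ^ 4) := by
    rw [← D.sup_eq_top]
    refine sup_le (fun y hy => kill 0 (by norm_num) y (cartan_le_gr rfl hy))
      (iSup₂_le fun β hβ y hy => ?_)
    rw [LinearMap.mem_ker]
    by_cases hm : cpair β δ = -2
    · have hy2 := step4 _ y (rs_le_gr hβ hm hy)
      rw [show (-2 + 4 : ℝ) = 2 by norm_num] at hy2
      have z1 := hzp _ (gr2 hy2)
      rw [(bound β hβ).2.2.2 hm] at hy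
      have z2 := hzn y hy
      have comm : ∀ v, ⁅z, A v⁆ = A v + A ⁅z, v⁆ := by
        intro v
        rw [hA, LieAlgebra.ad_apply, LieAlgebra.ad_apply, leibniz_lie, hz]
      have e4 : (A ^ 4) y = A (A (A (A y))) := rfl
      rw [e4] at z1 ⊢
      simp only [comm, z2, map_add, map_zero, add_zero] at z1
      have : (4 : ℂ) • A (A (A (A y))) = 0 := by rw [← z1]; module
      simpa using this
    · exact kill _ (lt_of_le_of_ne (bound β hβ).2.1 (Ne.symm hm)) y (rs_le_gr hβ rfl hy)
  rw [top_le_iff, LinearMap.ker_eq_top] at key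
  exact key

lemma Quad.mk' {D : RootSystemData V} {u : ℝ} {a b c d : V} (hu : 0 < u)
    (ha : a ∈ D.roots) (hb : b ∈ D.roots) (hc : c ∈ D.roots) (hd : d ∈ D.roots)
    (aa : ⟪a, a⟫ = 2 * u) (bb : ⟪b, b⟫ = 2 * u) (cc : ⟪c, c⟫ = 2 * u) (dd : ⟪d, d⟫ = 2 * u)
    (ab : ⟪a, b⟫ = 0) (cd : ⟪c, d⟫ = 0) (ac : ⟪a, c⟫ = u) (ad : ⟪a, d⟫ = u) (bc : ⟪b, c⟫ = u)
    (bd : ⟪b, d⟫ = u) (hδ : (2 : ℝ)⁻¹ • (a + b + c + d) ∈ D.roots)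
    (hle : ∀ β ∈ D.roots, ⟪β, β⟫ ≤ 4 * u) : Quad D u a b c d := by
  have hs : a + b = c + d := by
    rw [← sub_eq_zero, ← inner_self_eq_zero (𝕜 := ℝ)]
    simp only [real_inner_sub_sub_self, inner_add_left, inner_add_right, aa, bb, cc, dd, ab, cd,
      ac, ad, bc, bd, real_inner_comm a b, real_inner_comm c d]
    ring
  refine ⟨hu, ha, hb, hc, hd, aa, bb, cc, dd, ab, cd, ac, ad, bc, bd, hs, ?_, hle⟩
  convert hδ using 1
  rw [add_assoc (a + b), ← hs]; module

lemma Quad.final {u : ℝ} (γ : Fin 4 → V) (σ : Equiv.Perm (Fin 4))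
    (h : Quad D.toRootSystemData u (γ (σ 0)) (γ (σ 1)) (γ (σ 2)) (γ (σ 3))) :
    (∃ σ : Equiv.Perm (Fin 4), γ (σ 0) + γ (σ 1) = γ (σ 2) + γ (σ 3)) ∧
      IsSphericalSubspace (D.aSubspace (Set.range γ)) := by
  refine ⟨⟨σ, h.hsum⟩, ?_⟩
  intro x hx
  rw [LieRootData.aSubspace, iSup_range, ← σ.iSup_comp (g := fun i => D.rs (γ i)),
    Submodule.mem_iSup_iff_exists_finsupp] at hx
  obtain ⟨f, hf, rfl⟩ := hx
  rw [Finsupp.sum_fintype _ _ (by simp), Fin.sum_univ_four]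
  exact h.main (hf 0) (hf 1) (hf 2) (hf 3)

end lie

lemma arith_cases {p q r s t w m0 m1 m2 m3 : ℤ} (hp : 0 ≤ p) (hq : 0 ≤ q) (hr : 0 ≤ r)
    (hs : 0 ≤ s) (ht : 0 ≤ t) (hw : 0 ≤ w)
    (hone : p = 1 ∨ q = 1 ∨ r = 1 ∨ s = 1 ∨ t = 1 ∨ w = 1)
    (hS : p + q + r + s + t + w = 4)
    (r0 : 2 + p + q + r = 4 * m0) (r1 : p + 2 + s + t = 4 * m1)
    (r2 : q + s + 2 + w = 4 * m2) (r3 : r + t + w + 2 = 4 * m3) :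
    (p = 0 ∧ w = 0 ∧ q = 1 ∧ r = 1 ∧ s = 1 ∧ t = 1) ∨
      (q = 0 ∧ t = 0 ∧ p = 1 ∧ r = 1 ∧ s = 1 ∧ w = 1) ∨
      (r = 0 ∧ s = 0 ∧ p = 1 ∧ q = 1 ∧ t = 1 ∧ w = 1) := by
  have g0 : 1 ≤ m0 := by linarith only [show 0 < m0 by linarith only [r0, hp, hq, hr]]
  have g1 : 1 ≤ m1 := by linarith only [show 0 < m1 by linarith only [r1, hp, hs, ht]]
  have g2 : 1 ≤ m2 := by linarith only [show 0 < m2 by linarith only [r2, hq, hs, hw]]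
  have g3 : 1 ≤ m3 := by linarith only [show 0 < m3 by linarith only [r3, hr, ht, hw]]
  have e0 : m0 = 1 := by linarith
  have e1 : m1 = 1 := by linarith
  have e2 : m2 = 1 := by linarith
  have e3 : m3 = 1 := by linarith
  subst e0 e1 e2 e3
  have f1 : w = p := by linarith
  have f2 : t = q := by linarith
  have f3 : s = r := by linarith
  have f4 : r = 2 - p - q := by linarith
  subst f1 f2 f3 f4
  have b1 : w ≤ 2 := by linarith
  have b2 : t ≤ 2 := by linarith
  clear r0 r1 r2 r3 hS
  interval_cases w <;> interval_cases t <;> simp_all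

/-- Suppose `Φ` is doubly laced. Let `γ₁, γ₂, γ₃, γ₄ ∈ Φ⁺` be
(not necessarily distinct) short roots with `⟨γ_i, γ_j⟩ ≥ 0` for all `i, j`, with
`Γ = {γ₁, γ₂, γ₃, γ₄}` not orthogonal and `½(γ₁ + γ₂ + γ₃ + γ₄) ∈ Φ`. Then, up
to reordering, `γ₁ + γ₂ = γ₃ + γ₄`; moreover `𝔞_Γ = ⊕_{γ ∈ Γ} 𝔤_γ` is a spherical
subspace of `𝔫`. -/
theorem short_four_sum_spherical
    {V : Type*} [NormedAddCommGroup V] [InnerProductSpace ℝ V]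
    {L : Type*} [LieRing L] [LieAlgebra ℂ L]
    (D : LieRootData V L)
    (hirr : D.toRootSystemData.IsIrreducible)
    (hdl : D.toRootSystemData.DoublyLaced)
    (γ : Fin 4 → V) (hγ : ∀ i, γ i ∈ D.pos)
    (hshort : ∀ i, D.toRootSystemData.IsShort (γ i))
    (hpair : ∀ i j, 0 ≤ cpair (γ i) (γ j))
    (hnotorth : ¬ OrthogonalSet (Set.range γ))
    (hhalf : (2 : ℝ)⁻¹ • (γ 0 + γ 1 + γ 2 + γ 3) ∈ D.roots) :
    (∃ σ : Equiv.Perm (Fin 4), γ (σ 0) + γ (σ 1) = γ (σ 2) + γ (σ 3)) ∧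
      IsSphericalSubspace (D.aSubspace (Set.range γ)) := by
  have hroot : ∀ i, γ i ∈ D.roots := fun i => (hshort i).1
  set u : ℝ := ⟪γ 0, γ 0⟫ / 2 with hu_def
  have hnorm : ∀ i, ⟪γ i, γ i⟫ = 2 * u := by
    intro i
    have := (hshort i).2 _ (hroot 0)
    have := (hshort 0).2 _ (hroot i)
    rw [hu_def]; linarith
  have hu : 0 < u := by
    have : 0 < ⟪γ 0, γ 0⟫ := real_inner_self_pos.2 (D.ne_zero _ (hroot 0))
    rw [hu_def]; linarith
  have hnorms : ∀ β ∈ D.roots, ⟪β, β⟫ = 2 * u ∨ ⟪β, β⟫ = 4 * u := by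
    intro β hβ
    have h1 := (hshort 0).2 _ hβ
    have h2 := hdl.2 _ (hroot 0) _ hβ
    rw [hnorm] at h1 h2
    rcases h2 with h | h | h
    · left; linarith
    · right; linarith
    · linarith
  have hle : ∀ β ∈ D.roots, ⟪β, β⟫ ≤ 4 * u := by
    intro β hβ
    rcases hnorms β hβ with h | h <;> linarith
  -- integer inner products
  have hint : ∀ i j, ∃ n : ℤ, ⟪γ i, γ j⟫ = n * u := by
    intro i j
    obtain ⟨n, hn⟩ := D.crystallographic _ (hroot i) _ (hroot j)
    refine ⟨n, ?_⟩
    rw [← hn, cpair, hnorm]; field_simp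
  choose k hk using hint
  have ksymm : ∀ i j, k i j = k j i := by
    intro i j
    have h := real_inner_comm (γ i) (γ j)
    rw [hk, hk] at h
    exact_mod_cast (mul_right_cancel₀ hu.ne' h).symm
  have kdiag : ∀ i, k i i = 2 := by
    intro i
    have h := hk i i
    rw [hnorm] at h
    exact_mod_cast (mul_right_cancel₀ hu.ne' h).symm
  have knn : ∀ i j, 0 ≤ k i j := by
    intro i j
    have h := hpair i j
    rw [cpair, hnorm, hk] at h
    have e : 2 * (k i j * u) / (2 * u) = (k i j : ℝ) := by field_simp
    rw [e] at h
    exact_mod_cast h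
  have hsub : ∀ i j, ⟪γ i - γ j, γ i - γ j⟫ = (4 - 2 * k i j) * u := by
    intro i j
    rw [real_inner_sub_sub_self, hnorm, hnorm, hk]; ring
  have kle : ∀ i j, k i j ≤ 2 := by
    intro i j
    have h : 0 ≤ ⟪γ i - γ j, γ i - γ j⟫ := real_inner_self_nonneg
    rw [hsub] at h
    have : (0 : ℝ) ≤ 4 - 2 * k i j := nonneg_of_mul_nonneg_left h hu
    have : (k i j : ℝ) ≤ 2 := by linarith
    exact_mod_cast this
  have kone : ∃ i j, k i j = 1 := by
    by_contra! hno
    apply hnotorth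
    rintro _ ⟨i, rfl⟩ _ ⟨j, rfl⟩ hne
    have h2 : k i j ≠ 2 := by
      intro h2
      have := hsub i j
      rw [h2] at this
      norm_num at this
      exact hne (sub_eq_zero.1 this)
    have : k i j = 0 := by
      have := knn i j; have := kle i j; have := hno i j; omega
    rw [cpair, hk, this]; simp
  have hδδ : ⟪(2 : ℝ)⁻¹ • (γ 0 + γ 1 + γ 2 + γ 3), (2 : ℝ)⁻¹ • (γ 0 + γ 1 + γ 2 + γ 3)⟫ =
      (2 + (k 0 1 + k 0 2 + k 0 3 + k 1 2 + k 1 3 + k 2 3 : ℤ) / 2) * u := by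
    simp only [inner_smul_left, inner_smul_right, inner_add_left, inner_add_right, hk, kdiag,
      ksymm 1 0, ksymm 2 0, ksymm 3 0, ksymm 2 1, ksymm 3 1, ksymm 3 2]
    push_cast
    simp
    ring
  have hS : k 0 1 + k 0 2 + k 0 3 + k 1 2 + k 1 3 + k 2 3 = 0 ∨
      k 0 1 + k 0 2 + k 0 3 + k 1 2 + k 1 3 + k 2 3 = 4 := by
    rcases hnorms _ hhalf with h | h <;> rw [hδδ] at h <;> have h := mul_right_cancel₀ hu.ne' h
    · left
      have : ((k 0 1 + k 0 2 + k 0 3 + k 1 2 + k 1 3 + k 2 3 : ℤ) : ℝ) = 0 := by linarith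
      exact_mod_cast this
    · right
      have : ((k 0 1 + k 0 2 + k 0 3 + k 1 2 + k 1 3 + k 2 3 : ℤ) : ℝ) = 4 := by linarith
      exact_mod_cast this
  have n01 := knn 0 1
  have n02 := knn 0 2
  have n03 := knn 0 3
  have n12 := knn 1 2
  have n13 := knn 1 3
  have n23 := knn 2 3
  have hone : k 0 1 = 1 ∨ k 0 2 = 1 ∨ k 0 3 = 1 ∨ k 1 2 = 1 ∨ k 1 3 = 1 ∨ k 2 3 = 1 := by
    obtain ⟨i, j, hij⟩ := kone
    have d0 := kdiag 0
    have d1 := kdiag 1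
    have d2 := kdiag 2
    have d3 := kdiag 3
    have s1 := ksymm 1 0
    have s2 := ksymm 2 0
    have s3 := ksymm 3 0
    have s4 := ksymm 2 1
    have s5 := ksymm 3 1
    have s6 := ksymm 3 2
    fin_cases i <;> fin_cases j <;> simp at hij <;> omega
  have hS4 : k 0 1 + k 0 2 + k 0 3 + k 1 2 + k 1 3 + k 2 3 = 4 := by omega
  have hrow : ∀ i, ∃ n : ℤ, k i 0 + k i 1 + k i 2 + k i 3 = 4 * n := by
    intro i
    obtain ⟨n, hn⟩ := D.crystallographic _ (hroot i) _ hhalf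
    refine ⟨n, ?_⟩
    rw [cpair, hδδ, hS4] at hn
    simp only [inner_smul_right, inner_add_right, hk] at hn
    have : ((k i 0 + k i 1 + k i 2 + k i 3 : ℤ) : ℝ) = ((4 * n : ℤ) : ℝ) := by
      push_cast
      rw [← hn]
      field_simp
      push_cast
      ring
    exact_mod_cast this
  obtain ⟨m0, r0⟩ := hrow 0
  obtain ⟨m1, r1⟩ := hrow 1
  obtain ⟨m2, r2⟩ := hrow 2
  obtain ⟨m3, r3⟩ := hrow 3
  simp only [kdiag, ksymm 1 0, ksymm 2 0, ksymm 3 0, ksymm 2 1, ksymm 3 1, ksymm 3 2] at r0 r1 r2 r3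
  have build : ∀ σ : Equiv.Perm (Fin 4), k (σ 0) (σ 1) = 0 → k (σ 2) (σ 3) = 0 →
      k (σ 0) (σ 2) = 1 → k (σ 0) (σ 3) = 1 → k (σ 1) (σ 2) = 1 → k (σ 1) (σ 3) = 1 →
      γ (σ 0) + γ (σ 1) + γ (σ 2) + γ (σ 3) = γ 0 + γ 1 + γ 2 + γ 3 →
      Quad D.toRootSystemData u (γ (σ 0)) (γ (σ 1)) (γ (σ 2)) (γ (σ 3)) := by
    intro σ a1 a2 a3 a4 a5 a6 hs
    refine Quad.mk' hu (hroot _) (hroot _) (hroot _) (hroot _) (hnorm _) (hnorm _) (hnorm _)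
      (hnorm _) ?_ ?_ ?_ ?_ ?_ ?_ (by rw [hs]; exact hhalf) hle
    · rw [hk, a1]; simp
    · rw [hk, a2]; simp
    · rw [hk, a3]; simp
    · rw [hk, a4]; simp
    · rw [hk, a5]; simp
    · rw [hk, a6]; simp
  have cases : (k 0 1 = 0 ∧ k 2 3 = 0 ∧ k 0 2 = 1 ∧ k 0 3 = 1 ∧ k 1 2 = 1 ∧ k 1 3 = 1) ∨
      (k 0 2 = 0 ∧ k 1 3 = 0 ∧ k 0 1 = 1 ∧ k 0 3 = 1 ∧ k 1 2 = 1 ∧ k 2 3 = 1) ∨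
      (k 0 3 = 0 ∧ k 1 2 = 0 ∧ k 0 1 = 1 ∧ k 0 2 = 1 ∧ k 1 3 = 1 ∧ k 2 3 = 1) :=
    arith_cases n01 n02 n03 n12 n13 n23 hone hS4 r0 r1 r2 r3
  rcases cases with ⟨a1, a2, a3, a4, a5, a6⟩ | ⟨a1, a2, a3, a4, a5, a6⟩ | ⟨a1, a2, a3, a4, a5, a6⟩
  · exact Quad.final γ 1 (build 1 a1 a2 a3 a4 a5 a6 rfl)
  · have e0 : (Equiv.swap (1 : Fin 4) 2) 0 = 0 := by decide
    have e1 : (Equiv.swap (1 : Fin 4) 2) 1 = 2 := by decide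
    have e2 : (Equiv.swap (1 : Fin 4) 2) 2 = 1 := by decide
    have e3 : (Equiv.swap (1 : Fin 4) 2) 3 = 3 := by decide
    refine Quad.final γ (Equiv.swap 1 2) (build _ ?_ ?_ ?_ ?_ ?_ ?_ ?_)
    all_goals simp only [e0, e1, e2, e3, ksymm 2 1, ksymm 3 2, ksymm 3 1]
    all_goals first | assumption | abel
  · have e0 : (Equiv.swap (1 : Fin 4) 3) 0 = 0 := by decide
    have e1 : (Equiv.swap (1 : Fin 4) 3) 1 = 3 := by decide
    have e2 : (Equiv.swap (1 : Fin 4) 3) 2 = 2 := by decide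
    have e3 : (Equiv.swap (1 : Fin 4) 3) 3 = 1 := by decide
    refine Quad.final γ (Equiv.swap 1 3) (build _ ?_ ?_ ?_ ?_ ?_ ?_ ?_)
    all_goals simp only [e0, e1, e2, e3, ksymm 2 1, ksymm 3 2, ksymm 3 1]
    all_goals first | assumption | abel
end
end
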